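/- Let m ≥ 1, n ≥ 1 and let A_0,…,A_{2m−1}, B_0,…,B_{2n−1} be finite-dimensional complex Hilbert spaces; set H := A_0⊗⋯⊗A_{2m−1}⊗B_0⊗⋯⊗B_{2n−1}. Define the set of deterministic maps from m-combs to n-combs D(m→n) := { R : R is a positive semidefinite operator on H and for every M ∈ Comb_m(A_0,…,A_{2m−1}) the operator Tr_{A_0⊗⋯⊗A_{2m−1}}[(M⊗I_{B_0⊗⋯⊗B_{2n−1}})·R] belongs to Comb_n(B_0,…,B_{2n−1}) }. Let K_a be the set of positive semidefinite operators R on H whose image under the canonical tensor-factor permutation is a deterministic (m+n)-comb with respect to the tooth ordering (B_0,A_0),(A_1,A_2),(A_3,A_4),…,(A_{2m−3},A_{2m−2}),(A_{2m−1},B_1),(B_2,B_3),…,(B_{2n−2},B_{2n−1}), and let K_b be the analogous set for the tooth ordering (B_0,B_1),(B_2,B_3),…,(B_{2n−4},B_{2n−3}),(B_{2n−2},A_0),(A_1,A_2),…,(A_{2m−3},A_{2m−2}),(A_{2m−1},B_{2n−1}). Then D(m→n) equals the intersection of the set of positive semidefinite operators on H with the affine span (over ℝ, inside the Hermitian operators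 on H) of K_a ∪ K_b. -/

import Mathlib

open Matrix Kronecker ComplexOrder

noncomputable section

private theorem cast_pi {G : ℕ → Type} {q : ℕ} (f : ∀ j : Fin q, G j) {a b : ℕ}
    (h : a = b) (ha : a < q) (hb : b < q) :
    cast (congrArg G h) (f ⟨a, ha⟩) = f ⟨b, hb⟩ := by subst h; rfl

/-- Reinterpreting a tensor product along an equality of the number of factors. -/
def piFinCast (H : ℕ → Type) {q q' : ℕ} (h : q = q') :
    (∀ j : Fin q, H j) ≃ (∀ j : Fin q', H j) where
  toFun f j := f ⟨j, h ▸ j.isLt⟩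
  invFun f j := f ⟨j, h ▸ j.isLt⟩
  left_inv f := rfl
  right_inv f := rfl

/-- The canonical identification of `H_0 ⊗ H_1 ⊗ ⋯ ⊗ H_{k+1}` with
`H_0 ⊗ (H_1 ⊗ ⋯ ⊗ H_k) ⊗ H_{k+1}`. -/
def splitEnds (H : ℕ → Type) (k : ℕ) :
    (∀ j : Fin (k + 2), H j) ≃ (H 0 × (∀ j : Fin k, H (j + 1)) × H (k + 1)) where
  toFun f := (f ⟨0, by omega⟩, fun j => f ⟨(j : ℕ) + 1, by omega⟩, f ⟨k + 1, by omega⟩)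
  invFun x j :=
    if h0 : (j : ℕ) = 0 then cast (congrArg H h0.symm) x.1
    else if hk : (j : ℕ) = k + 1 then cast (congrArg H hk.symm) x.2.2
    else cast (congrArg H (by omega : (j : ℕ) - 1 + 1 = (j : ℕ)))
      (x.2.1 ⟨(j : ℕ) - 1, by omega⟩)
  left_inv f := by
    funext j
    dsimp only
    split_ifs with h0 hk
    · exact cast_pi f h0.symm (by omega) (by omega)
    · exact cast_pi f hk.symm (by omega) (by omega)
    · exact cast_pi f (by omega) (by omega) (by omega)
  right_inv x := by
    obtain ⟨a, g, b⟩ := x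
    refine Prod.ext ?_ (Prod.ext ?_ ?_)
    · rfl
    · funext j
      dsimp only
      rw [dif_neg (by omega), dif_neg (by have := j.isLt; omega)]
      exact cast_eq _ (g j)
    · dsimp only
      rw [dif_neg (by omega), dif_pos rfl]
      exact cast_eq _ b


/-- Partial trace over the middle tensor factor. -/
def ptrMid {α β γ : Type*} [Fintype β] (M : Matrix (α × β × γ) (α × β × γ) ℂ) :
    Matrix (α × γ) (α × γ) ℂ :=
  fun p q => ∑ b, M (p.1, b, p.2) (q.1, b, q.2)

/-- Partial trace over the last of `k+1` tensor factors. -/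
def trLast {H : ℕ → Type} [∀ j, Fintype (H j)] (k : ℕ)
    (R : Matrix (∀ j : Fin (k + 1), H j) (∀ j : Fin (k + 1), H j) ℂ) :
    Matrix (∀ j : Fin k, H j) (∀ j : Fin k, H j) ℂ :=
  fun u v => ∑ b : H k, R (Fin.snoc u b) (Fin.snoc v b)

/-- The set of deterministic 1-combs on a pair of factors `α ⊗ β`: positive semidefinite
operators whose partial trace over `β` is the identity on `α`. -/
def comb1Set (α β : Type*) [Fintype α] [DecidableEq α] [Fintype β] :
    Set (Matrix (α × β) (α × β) ℂ) :=
  {M | M.PosSemidef ∧ (fun a a' => ∑ b, M (a, b) (a', b)) = (1 : Matrix α α ℂ)}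

/-- The set `Comb_n(H_0,…,H_{2n−1})` of deterministic `n`-combs, defined recursively:
a `1`-comb is a PSD operator `R` on `H_0⊗H_1` with `Tr_{H_1}[R] = I_{H_0}`; an `n`-comb
(`n ≥ 2`) is a PSD operator `R` on `H_0⊗⋯⊗H_{2n−1}` such that for every `(n−1)`-comb `S` on
`H_1⊗⋯⊗H_{2n−2}` the operator `Tr_{H_1⊗⋯⊗H_{2n−2}}[(I_{H_0}⊗S⊗I_{H_{2n−1}})·R]` is a
`1`-comb on `H_0⊗H_{2n−1}`.  (The value at `n = 0` is irrelevant and set to `∅`.) -/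
def Comb : (n : ℕ) → (H : ℕ → Type) → [∀ j, Fintype (H j)] → [∀ j, DecidableEq (H j)] →
    Set (Matrix (∀ j : Fin (2 * n), H j) (∀ j : Fin (2 * n), H j) ℂ)
  | 0, _, _, _ => ∅
  | 1, H, _, _ => {R | R.PosSemidef ∧ trLast 1 R = (1 : Matrix (∀ j : Fin 1, H j) (∀ j : Fin 1, H j) ℂ)}
  | (n + 2), H, _, _ =>
    {R | R.PosSemidef ∧ ∀ S ∈ Comb (n + 1) (fun m => H (m + 1)),
      ptrMid (((1 : Matrix (H 0) (H 0) ℂ) ⊗ₖ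
          (S ⊗ₖ (1 : Matrix (H (2 * (n + 1) + 1)) (H (2 * (n + 1) + 1)) ℂ))) *
        (Matrix.reindex (splitEnds H (2 * (n + 1))) (splitEnds H (2 * (n + 1))) R)) ∈
      comb1Set (H 0) (H (2 * (n + 1) + 1))}


/-- The partial trace over the first tensor factor. -/
def ptrLeft {α β : Type*} [Fintype α] (M : Matrix (α × β) (α × β) ℂ) : Matrix β β ℂ :=
  fun b b' => ∑ a, M (a, b) (a, b')

/-- The canonical identification of `H_0⊗⋯⊗H_{a+b−1}` with
`(H_0⊗⋯⊗H_{a−1}) ⊗ (H_a⊗⋯⊗H_{a+b−1})`. -/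
def splitPi (a b : ℕ) (H : ℕ → Type) :
    (∀ j : Fin (a + b), H j) ≃ ((∀ j : Fin a, H j) × (∀ j : Fin b, H (a + j))) where
  toFun f := (fun j => f (Fin.castAdd b j), fun j => f (Fin.natAdd a j))
  invFun x j :=
    if h : (j : ℕ) < a then x.1 ⟨(j : ℕ), h⟩
    else cast (congrArg H (by omega : a + ((j : ℕ) - a) = (j : ℕ)))
      (x.2 ⟨(j : ℕ) - a, by omega⟩)
  left_inv f := by
    funext j
    dsimp only
    split_ifs with h
    · rfl
    · exact cast_pi f (show a + ((j : ℕ) - a) = (j : ℕ) by omega) (by omega) j.isLt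
  right_inv x := by
    obtain ⟨u, v⟩ := x
    refine Prod.ext ?_ ?_
    · funext j
      dsimp only
      rw [dif_pos (show ((Fin.castAdd b j : Fin (a + b)) : ℕ) < a from j.isLt)]
      rfl
    · funext j
      dsimp only
      rw [dif_neg (show ¬(((Fin.natAdd a j : Fin (a + b)) : ℕ) < a) by
        simp only [Fin.coe_natAdd]; omega)]
      exact cast_pi (G := fun m => H (a + m)) v
        (show ((Fin.natAdd a j : Fin (a + b)) : ℕ) - a = (j : ℕ) by
          simp only [Fin.coe_natAdd]; omega)
        (by simp only [Fin.coe_natAdd]; omega) j.isLt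

/-- Extension of a permutation of `Fin q` to `ℕ` (fixing everything `≥ q`). -/
def extendPerm {q : ℕ} (σ : Equiv.Perm (Fin q)) : ℕ → ℕ :=
  fun i => if h : i < q then (σ ⟨i, h⟩ : ℕ) else i

/-- The canonical tensor-factor permutation: reinterpreting an element of
`H_0⊗⋯⊗H_{q−1}` as an element of `H_{σ(0)}⊗⋯⊗H_{σ(q−1)}` (the space whose `j`-th factor is
the original factor `σ(j)`). -/
def permEquiv (H : ℕ → Type) {q : ℕ} (σ : Equiv.Perm (Fin q)) :
    (∀ j : Fin q, H j) ≃ (∀ j : Fin q, H (extendPerm σ j)) :=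
  (Equiv.piCongrLeft' (fun i : Fin q => H i) σ.symm).trans
    (Equiv.piCongrRight fun j =>
      Equiv.cast (congrArg H (by simp [extendPerm] : ((σ j : Fin q) : ℕ) = extendPerm σ j)))

/-- The factor ordering of `K_a` in STATEMENT 0 (as a map sending each position of the
reordered sequence `B_0,A_0,A_1,…,A_{2m−1},B_1,…,B_{2n−1}` to the corresponding position in
the original sequence `A_0,…,A_{2m−1},B_0,…,B_{2n−1}`): position `0` holds `B_0` (original
position `2m`); positions `1,…,2m` hold `A_0,…,A_{2m−1}`; positions `i > 2m` are fixed. -/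
def cycleKA (m n : ℕ) (hm : 1 ≤ m) (hn : 1 ≤ n) : Equiv.Perm (Fin (2 * m + 2 * n)) where
  toFun j := ⟨if (j : ℕ) = 0 then 2 * m else if (j : ℕ) ≤ 2 * m then (j : ℕ) - 1 else (j : ℕ),
    by have := j.isLt; split_ifs <;> omega⟩
  invFun j := ⟨if (j : ℕ) = 2 * m then 0 else if (j : ℕ) < 2 * m then (j : ℕ) + 1 else (j : ℕ),
    by have := j.isLt; split_ifs <;> omega⟩
  left_inv j := by
    have := j.isLt
    apply Fin.ext
    simp only [Fin.val_mk]
    split_ifs <;> first | omega | exact (‹False›).elim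
  right_inv j := by
    have := j.isLt
    apply Fin.ext
    simp only [Fin.val_mk]
    split_ifs <;> first | omega | exact (‹False›).elim

/-- The factor ordering of `K_b` in STATEMENT 0 (as a map sending each position of the
reordered sequence `B_0,B_1,…,B_{2n−2},A_0,…,A_{2m−1},B_{2n−1}` to the corresponding
position in the original sequence `A_0,…,A_{2m−1},B_0,…,B_{2n−1}`): positions
`0,…,2n−2` hold `B_0,…,B_{2n−2}` (original positions `2m,…,2m+2n−2`); positions
`2n−1,…,2n−2+2m` hold `A_0,…,A_{2m−1}`; the last position (holding `B_{2n−1}`) is fixed. -/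
def cycleKB (m n : ℕ) (hm : 1 ≤ m) (hn : 1 ≤ n) : Equiv.Perm (Fin (2 * m + 2 * n)) where
  toFun j := ⟨if (j : ℕ) < 2 * n - 1 then 2 * m + (j : ℕ)
      else if (j : ℕ) < 2 * n - 1 + 2 * m then (j : ℕ) - (2 * n - 1) else (j : ℕ),
    by have := j.isLt; split_ifs <;> omega⟩
  invFun j := ⟨if (j : ℕ) < 2 * m then (j : ℕ) + (2 * n - 1)
      else if (j : ℕ) < 2 * m + 2 * n - 1 then (j : ℕ) - 2 * m else (j : ℕ),
    by have := j.isLt; split_ifs <;> omega⟩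
  left_inv j := by
    have := j.isLt
    apply Fin.ext
    simp only [Fin.val_mk]
    split_ifs <;> first | omega | exact (‹False›).elim
  right_inv j := by
    have := j.isLt
    apply Fin.ext
    simp only [Fin.val_mk]
    split_ifs <;> first | omega | exact (‹False›).elim



def TT (q : ℕ) (H : ℕ → Type) (A : ∀ j, Matrix (H j) (H j) ℂ) :
    Matrix (∀ j : Fin q, H j) (∀ j : Fin q, H j) ℂ :=
  fun x y => ∏ j : Fin q, A j (x j) (y j)

section TTlemmas
variable {q : ℕ} {H : ℕ → Type} [∀ j, Fintype (H j)] [∀ j, DecidableEq (H j)]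

theorem TT_congr {A B : ∀ j, Matrix (H j) (H j) ℂ} (h : ∀ j < q, A j = B j) :
    TT q H A = TT q H B := by
  ext x y
  exact Finset.prod_congr rfl fun j _ => by rw [h j j.isLt]

theorem TT_one : TT q H (fun _ => 1) = 1 := by
  ext x y
  simp only [TT, Matrix.one_apply]
  by_cases h : x = y
  · subst h; simp
  · rw [if_neg h]
    obtain ⟨j, hj⟩ := Function.ne_iff.mp h
    exact Finset.prod_eq_zero (Finset.mem_univ j) (if_neg hj)

theorem TT_mul (A B : ∀ j, Matrix (H j) (H j) ℂ) :
    TT q H A * TT q H B = TT q H (fun j => A j * B j) := by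
  ext x y
  simp only [TT, Matrix.mul_apply]
  rw [Finset.prod_univ_sum]
  simp only [Finset.prod_mul_distrib, Fintype.piFinset_univ]

theorem TT_trace (A : ∀ j, Matrix (H j) (H j) ℂ) :
    trace (TT q H A) = ∏ j : Fin q, trace (A j) := by
  simp only [TT, Matrix.trace, Matrix.diag]
  rw [Finset.prod_univ_sum]
  simp only [Fintype.piFinset_univ]

theorem TT_herm {A : ∀ j, Matrix (H j) (H j) ℂ} (h : ∀ j < q, (A j).IsHermitian) :
    (TT q H A).IsHermitian := by
  ext x y
  simp only [TT, Matrix.conjTranspose_apply, star_prod]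
  exact Finset.prod_congr rfl fun j _ => (h j j.isLt).apply _ _

theorem TT_trace_zero {A : ∀ j, Matrix (H j) (H j) ℂ} {k : ℕ} (hk : k < q)
    (h : trace (A k) = 0) : trace (TT q H A) = 0 := by
  rw [TT_trace]
  exact Finset.prod_eq_zero (Finset.mem_univ ⟨k, hk⟩) h

theorem TT_pair_zero {A B : ∀ j, Matrix (H j) (H j) ℂ} {k : ℕ} (hk : k < q)
    (h : trace (A k * B k) = 0) : trace (TT q H A * TT q H B) = 0 := by
  rw [TT_mul]; exact TT_trace_zero (A := fun j => A j * B j) hk h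

def PureF (q : ℕ) (H : ℕ → Type) [∀ j, Fintype (H j)] [∀ j, DecidableEq (H j)]
    (s : Finset ℕ) (A : ∀ j, Matrix (H j) (H j) ℂ) : Prop :=
  s ⊆ Finset.range q ∧ ∀ j < q, (A j).IsHermitian ∧ (j ∈ s → trace (A j) = 0) ∧ (j ∉ s → A j = 1)

theorem pure_orth {s t : Finset ℕ} {A B : ∀ j, Matrix (H j) (H j) ℂ}
    (hA : PureF q H s A) (hB : PureF q H t B) (hst : s ≠ t) :
    trace (TT q H A * TT q H B) = 0 := by
  obtain ⟨j, hj⟩ : ∃ j, ¬ (j ∈ s ↔ j ∈ t) := by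
    by_contra h; push Not at h; exact hst (Finset.ext h)
  have hjq : j < q := by
    by_contra h
    apply hj
    constructor
    · intro h'; exact absurd (Finset.mem_range.mp (hA.1 h')) h
    · intro h'; exact absurd (Finset.mem_range.mp (hB.1 h')) h
  apply TT_pair_zero hjq
  by_cases h1 : j ∈ s
  · have h2 : j ∉ t := by tauto
    rw [(hB.2 j hjq).2.2 h2, mul_one]; exact (hA.2 j hjq).2.1 h1
  · have h2 : j ∈ t := by tauto
    rw [(hA.2 j hjq).2.2 h1, one_mul]; exact (hB.2 j hjq).2.1 h2

theorem mat_span {α : Type} [Fintype α] [DecidableEq α] (X : Matrix α α ℂ) :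
    X ∈ Submodule.span ℂ {Y : Matrix α α ℂ | Y.IsHermitian ∧ (Y = 1 ∨ trace Y = 0)} := by
  classical
  have herm0 : ∀ Y : Matrix α α ℂ, Y.IsHermitian →
      Y ∈ Submodule.span ℂ {Y : Matrix α α ℂ | Y.IsHermitian ∧ (Y = 1 ∨ trace Y = 0)} := by
    intro Y hY
    rcases isEmpty_or_nonempty α with h | h
    · apply Submodule.subset_span
      exact ⟨hY, Or.inl (Subsingleton.elim _ _)⟩
    · have hd : (Fintype.card α : ℂ) ≠ 0 := by exact_mod_cast Fintype.card_ne_zero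
      have htr : star (trace Y) = trace Y := by rw [← Matrix.trace_conjTranspose, hY.eq]
      have : Y = (trace Y / Fintype.card α) • (1 : Matrix α α ℂ)
          + (Y - (trace Y / Fintype.card α) • (1 : Matrix α α ℂ)) := by abel
      rw [this]
      refine Submodule.add_mem _ (Submodule.smul_mem _ _ (Submodule.subset_span
        ⟨Matrix.isHermitian_one, Or.inl rfl⟩)) (Submodule.subset_span ⟨?_, Or.inr ?_⟩)
      · have h1 : star (trace Y / (Fintype.card α : ℂ)) = trace Y / (Fintype.card α : ℂ) := by
          rw [star_div₀, htr]; simp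
        rw [Matrix.IsHermitian, Matrix.conjTranspose_sub, Matrix.conjTranspose_smul, h1, hY.eq]
        simp
      · simp [hd]
  have : X = (2⁻¹ : ℂ) • (X + Xᴴ) + ((2⁻¹ : ℂ) * (-Complex.I)) • (Complex.I • (X - Xᴴ)) := by
    rw [smul_smul, mul_assoc]
    simp only [neg_mul, Complex.I_mul_I, neg_neg, mul_one]
    rw [← smul_add, add_add_sub_cancel, ← two_smul ℂ X, smul_smul]
    norm_num
  rw [this]
  refine Submodule.add_mem _ (Submodule.smul_mem _ _ (herm0 _ ?_))
    (Submodule.smul_mem _ _ (herm0 _ ?_))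
  · exact Matrix.isHermitian_add_transpose_self X
  · rw [Matrix.IsHermitian, Matrix.conjTranspose_smul, Matrix.conjTranspose_sub,
      Matrix.conjTranspose_conjTranspose]
    simp [smul_sub]
    abel

theorem TT_update (A : ∀ j, Matrix (H j) (H j) ℂ) {k : ℕ} (hk : k < q) (X : Matrix (H k) (H k) ℂ)
    (x y : ∀ j : Fin q, H j) :
    TT q H (Function.update A k X) x y =
      X (x ⟨k, hk⟩) (y ⟨k, hk⟩) * ∏ j ∈ Finset.univ.erase (⟨k, hk⟩ : Fin q), A j (x j) (y j) := by
  unfold TT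
  rw [← Finset.mul_prod_erase _ _ (Finset.mem_univ (⟨k, hk⟩ : Fin q))]
  congr 1
  · simp
  · refine Finset.prod_congr rfl fun j hj => ?_
    rw [Function.update_of_ne]
    intro h
    exact (Finset.mem_erase.mp hj).1 (Fin.ext h)

theorem TT_mem_span (A : ∀ j, Matrix (H j) (H j) ℂ) :
    TT q H A ∈ Submodule.span ℂ {X | ∃ s B, PureF q H s B ∧ X = TT q H B} := by
  classical
  have key : ∀ k, k ≤ q → ∀ A : ∀ j, Matrix (H j) (H j) ℂ,
      (∀ j, k ≤ j → j < q → (A j).IsHermitian ∧ (A j = 1 ∨ trace (A j) = 0)) →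
      TT q H A ∈ Submodule.span ℂ {X | ∃ s B, PureF q H s B ∧ X = TT q H B} := by
    intro k
    induction k with
    | zero =>
      intro _ A hA
      refine Submodule.subset_span ⟨(Finset.range q).filter (fun j => A j ≠ 1), A,
        ⟨Finset.filter_subset _ _, fun j hj => ⟨(hA j (Nat.zero_le _) hj).1, ?_, ?_⟩⟩, rfl⟩
      · intro h
        exact (hA j (Nat.zero_le _) hj).2.resolve_left (Finset.mem_filter.mp h).2
      · intro h
        by_contra h'
        exact h (Finset.mem_filter.mpr ⟨Finset.mem_range.mpr hj, h'⟩)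
    | succ k ih =>
      intro hk A hA
      have hk' : k < q := hk
      have : ∀ X : Matrix (H k) (H k) ℂ, X ∈ Submodule.span ℂ
          {Y : Matrix (H k) (H k) ℂ | Y.IsHermitian ∧ (Y = 1 ∨ trace Y = 0)} →
          TT q H (Function.update A k X) ∈
            Submodule.span ℂ {X | ∃ s B, PureF q H s B ∧ X = TT q H B} := by
        intro X hX
        induction hX using Submodule.span_induction with
        | mem X hX =>
          apply ih hk'.le
          intro j hj hjq
          rcases Nat.eq_or_lt_of_le hj with h | h
          · subst h; simpa using hX
          · rw [Function.update_of_ne (by omega)]; exact hA j h hjq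
        | zero =>
          have : TT q H (Function.update A k 0) = 0 := by
            ext x y; rw [TT_update A hk']; simp
          rw [this]; exact Submodule.zero_mem _
        | add X Y _ _ h1 h2 =>
          have : TT q H (Function.update A k (X + Y)) =
              TT q H (Function.update A k X) + TT q H (Function.update A k Y) := by
            ext x y; rw [Matrix.add_apply]; simp only [TT_update A hk', Matrix.add_apply]; ring
          rw [this]; exact Submodule.add_mem _ h1 h2
        | smul a X _ h1 =>
          have : TT q H (Function.update A k (a • X)) =
              a • TT q H (Function.update A k X) := by
            ext x y; rw [Matrix.smul_apply]
            simp only [TT_update A hk', Matrix.smul_apply, smul_eq_mul]; ring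
          rw [this]; exact Submodule.smul_mem _ _ h1
      have h := this (A k) (mat_span _)
      rwa [Function.update_eq_self] at h
  exact key q le_rfl A (fun j h1 h2 => absurd h2 (by omega))

theorem all_span (R : Matrix (∀ j : Fin q, H j) (∀ j : Fin q, H j) ℂ) :
    R ∈ Submodule.span ℂ {X | ∃ s B, PureF q H s B ∧ X = TT q H B} := by
  classical
  rw [Matrix.matrix_eq_sum_single R]
  refine Submodule.sum_mem _ fun x _ => Submodule.sum_mem _ fun y _ => ?_
  have : Matrix.single x y (R x y) = R x y • TT q H
      (fun j => if h : j < q then Matrix.single (x ⟨j, h⟩) (y ⟨j, h⟩) 1 else 1) := by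
    ext u v
    rw [Matrix.smul_apply]
    simp only [TT, Matrix.single_apply, Fin.is_lt, dif_pos, smul_eq_mul]
    by_cases h : x = u ∧ y = v
    · obtain ⟨rfl, rfl⟩ := h
      simp
    · rw [if_neg h]
      have : ∃ j, ¬ (x j = u j ∧ y j = v j) := by
        by_contra h'
        push Not at h'
        exact h ⟨funext fun j => (h' j).1, funext fun j => (h' j).2⟩
      obtain ⟨j, hj⟩ := this
      rw [Finset.prod_eq_zero (Finset.mem_univ j) (if_neg hj), mul_zero]
  rw [this]
  exact Submodule.smul_mem _ _ (TT_mem_span _)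

theorem trace_pair_zero_of_span {α : Type*} [Fintype α] {W : Set (Matrix α α ℂ)}
    {R X : Matrix α α ℂ} (hX : X ∈ Submodule.span ℂ W) (h : ∀ Y ∈ W, trace (R * Y) = 0) :
    trace (R * X) = 0 := by
  induction hX using Submodule.span_induction with
  | mem X hX => exact h X hX
  | zero => simp
  | add X Y _ _ h1 h2 => rw [mul_add, trace_add, h1, h2, add_zero]
  | smul a X _ h1 => rw [mul_smul_comm, trace_smul, h1, smul_zero]

theorem decomp (R : Matrix (∀ j : Fin q, H j) (∀ j : Fin q, H j) ℂ) :
    R ∈ Submodule.span ℂ {X | ∃ s A, PureF q H s A ∧ X = TT q H A ∧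
      ∃ A', PureF q H s A' ∧ trace (R * TT q H A') ≠ 0} := by
  classical
  let W : Finset ℕ → Submodule ℂ (Matrix (∀ j : Fin q, H j) (∀ j : Fin q, H j) ℂ) :=
    fun s => Submodule.span ℂ {X | ∃ A, PureF q H s A ∧ X = TT q H A}
  have hR : R ∈ ⨆ s, W s := by
    refine Submodule.span_le.mpr ?_ (all_span R)
    rintro X ⟨s, A, hA, rfl⟩
    exact Submodule.mem_iSup_of_mem s (Submodule.subset_span ⟨A, hA, rfl⟩)
  obtain ⟨f, hf, hsum⟩ := (Submodule.mem_iSup_iff_exists_finsupp W R).mp hR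
  have orth : ∀ s t, s ≠ t → ∀ A, PureF q H t A → trace (f s * TT q H A) = 0 := by
    intro s t hst A hA
    rw [Matrix.trace_mul_comm]
    refine trace_pair_zero_of_span (hf s) ?_
    rintro _ ⟨B, hB, rfl⟩
    exact pure_orth hA hB (Ne.symm hst)
  have htr : ∀ t A, PureF q H t A → trace (R * TT q H A) = trace (f t * TT q H A) := by
    intro t A hA
    rw [← hsum, Finsupp.sum, Finset.sum_mul, Matrix.trace_sum]
    rw [Finset.sum_eq_single t]
    · intro s _ hs; exact orth s t hs A hA
    · intro h; rw [Finsupp.notMem_support_iff.mp h]; simp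
  suffices hh : (f.sum fun _ x => x) ∈ Submodule.span ℂ {X | ∃ s A, PureF q H s A ∧ X = TT q H A ∧
      ∃ A', PureF q H s A' ∧ trace (R * TT q H A') ≠ 0} by rwa [hsum] at hh
  refine Submodule.sum_mem _ fun s hs => ?_
  by_cases h : ∃ A', PureF q H s A' ∧ trace (R * TT q H A') ≠ 0
  · refine Submodule.span_mono ?_ (hf s)
    rintro _ ⟨A, hA, rfl⟩
    exact ⟨s, A, hA, rfl, h⟩
  · exfalso
    push Not at h
    apply Finsupp.mem_support_iff.mp hs
    apply Matrix.ext_iff_trace_mul_right.mpr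
    intro X
    rw [zero_mul, trace_zero]
    refine trace_pair_zero_of_span (all_span X) ?_
    rintro _ ⟨t, A, hA, rfl⟩
    by_cases hst : s = t
    · subst hst; rw [← htr s A hA]; exact h A hA
    · exact orth s t hst A hA

end TTlemmas

section PSDlemmas

theorem psd_perturb {α : Type*} [Fintype α] [DecidableEq α] {X : Matrix α α ℂ}
    (hX : X.IsHermitian) {c : ℝ} (hc : 0 < c) :
    ∃ ε : ℝ, 0 < ε ∧ ((c : ℂ) • (1 : Matrix α α ℂ) + (ε : ℂ) • X).PosSemidef := by
  have hB : 0 < ∑ i, |hX.eigenvalues i| + 1 := by positivity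
  refine ⟨c / (∑ i, |hX.eigenvalues i| + 1), by positivity, ?_⟩
  set ε := c / (∑ i, |hX.eigenvalues i| + 1) with hε
  have hε0 : 0 < ε := by positivity
  have hD : (Matrix.diagonal (fun i => ((c + ε * hX.eigenvalues i : ℝ) : ℂ))).PosSemidef := by
    refine Matrix.PosSemidef.diagonal fun i => ?_
    simp only [Pi.zero_apply]
    rw [Complex.zero_le_real]
    have h1 : |hX.eigenvalues i| ≤ ∑ i, |hX.eigenvalues i| :=
      Finset.single_le_sum (f := fun i => |hX.eigenvalues i|) (fun _ _ => abs_nonneg _)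
        (Finset.mem_univ i)
    have h2 : ε * (∑ i, |hX.eigenvalues i| + 1) = c := by
      rw [hε]; field_simp
    have h3 := neg_abs_le (hX.eigenvalues i)
    nlinarith
  have key := hD.mul_mul_conjTranspose_same (hX.eigenvectorUnitary : Matrix α α ℂ)
  have hU : (hX.eigenvectorUnitary : Matrix α α ℂ) * (hX.eigenvectorUnitary : Matrix α α ℂ)ᴴ = 1 := by
    rw [← Matrix.star_eq_conjTranspose]; exact Unitary.coe_mul_star_self _
  have hs := hX.spectral_theorem
  rw [Unitary.conjStarAlgAut_apply] at hs
  have hd : Matrix.diagonal (fun i => ((c + ε * hX.eigenvalues i : ℝ) : ℂ)) =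
      (c : ℂ) • (1 : Matrix α α ℂ) + (ε : ℂ) • Matrix.diagonal (RCLike.ofReal ∘ hX.eigenvalues) := by
    ext i j
    by_cases h : i = j
    · subst h; simp
    · simp [h]
  rw [hd, mul_add, add_mul] at key
  rw [mul_smul_comm, smul_mul_assoc, mul_one, hU, mul_smul_comm, smul_mul_assoc] at key
  rw [Matrix.star_eq_conjTranspose] at hs
  rw [← hs] at key
  exact key

variable {α β γ : Type*} [Fintype α] [Fintype β] [Fintype γ]
  [DecidableEq α] [DecidableEq β] [DecidableEq γ]

theorem ptrMid_psd {Z : Matrix (α × β × γ) (α × β × γ) ℂ} (hZ : Z.PosSemidef) :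
    (ptrMid Z).PosSemidef := by
  have : ptrMid Z = ∑ b, Z.submatrix (fun p : α × γ => (p.1, b, p.2)) (fun p => (p.1, b, p.2)) := by
    ext p q; simp [ptrMid, Matrix.sum_apply]
  rw [this]
  exact Matrix.posSemidef_sum _ fun b _ => hZ.submatrix _

theorem ptrLeft_psd {Z : Matrix (α × β) (α × β) ℂ} (hZ : Z.PosSemidef) :
    (ptrLeft Z).PosSemidef := by
  have : ptrLeft Z = ∑ b, Z.submatrix (fun p : β => (b, p)) (fun p => (b, p)) := by
    ext p q; simp [ptrLeft, Matrix.sum_apply]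
  rw [this]
  exact Matrix.posSemidef_sum _ fun b _ => hZ.submatrix _

theorem ptrMid_cyc (C : Matrix β β ℂ) (Z : Matrix (α × β × γ) (α × β × γ) ℂ) :
    ptrMid (((1 : Matrix α α ℂ) ⊗ₖ (C ⊗ₖ (1 : Matrix γ γ ℂ))) * Z) =
      ptrMid (Z * ((1 : Matrix α α ℂ) ⊗ₖ (C ⊗ₖ (1 : Matrix γ γ ℂ)))) := by
  ext p q
  simp only [ptrMid, Matrix.mul_apply, Fintype.sum_prod_type, Matrix.kroneckerMap_apply,
    Matrix.one_apply]
  simp only [ite_mul, mul_ite, one_mul, zero_mul, mul_one, mul_zero, Finset.sum_ite_eq,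
    Finset.sum_ite_eq', Finset.mem_univ, if_true, Finset.sum_ite_irrel, Finset.sum_const_zero]
  rw [Finset.sum_comm]
  simp only [mul_comm]

theorem ptrLeft_cyc (C : Matrix α α ℂ) (Z : Matrix (α × β) (α × β) ℂ) :
    ptrLeft ((C ⊗ₖ (1 : Matrix β β ℂ)) * Z) = ptrLeft (Z * (C ⊗ₖ (1 : Matrix β β ℂ))) := by
  ext p q
  simp only [ptrLeft, Matrix.mul_apply, Fintype.sum_prod_type, Matrix.kroneckerMap_apply,
    Matrix.one_apply]
  simp only [ite_mul, mul_ite, one_mul, zero_mul, mul_one, mul_zero, Finset.sum_ite_eq,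
    Finset.sum_ite_eq', Finset.mem_univ, if_true, Finset.sum_ite_irrel, Finset.sum_const_zero]
  rw [Finset.sum_comm]
  simp only [mul_comm]

open scoped MatrixOrder in
theorem psd_eq_mul {S : Matrix β β ℂ} (hS : S.PosSemidef) : ∃ C : Matrix β β ℂ, S = Cᴴ * C := by
  obtain ⟨C, hC⟩ := CStarAlgebra.nonneg_iff_eq_star_mul_self.mp hS.nonneg
  exact ⟨C, hC⟩

theorem ptrMid_link_psd {S : Matrix β β ℂ} (hS : S.PosSemidef)
    {Z : Matrix (α × β × γ) (α × β × γ) ℂ} (hZ : Z.PosSemidef) :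
    (ptrMid (((1 : Matrix α α ℂ) ⊗ₖ (S ⊗ₖ (1 : Matrix γ γ ℂ))) * Z)).PosSemidef := by
  obtain ⟨C, rfl⟩ := psd_eq_mul hS
  have : ((1 : Matrix α α ℂ) ⊗ₖ ((Cᴴ * C) ⊗ₖ (1 : Matrix γ γ ℂ))) =
      ((1 : Matrix α α ℂ) ⊗ₖ (C ⊗ₖ (1 : Matrix γ γ ℂ)))ᴴ *
        ((1 : Matrix α α ℂ) ⊗ₖ (C ⊗ₖ (1 : Matrix γ γ ℂ))) := by
    rw [Matrix.conjTranspose_kronecker, Matrix.conjTranspose_kronecker, ← Matrix.mul_kronecker_mul,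
      ← Matrix.mul_kronecker_mul]
    simp
  rw [this, mul_assoc]
  have h2 : ((1 : Matrix α α ℂ) ⊗ₖ (C ⊗ₖ (1 : Matrix γ γ ℂ)))ᴴ =
      ((1 : Matrix α α ℂ) ⊗ₖ (Cᴴ ⊗ₖ (1 : Matrix γ γ ℂ))) := by
    rw [Matrix.conjTranspose_kronecker, Matrix.conjTranspose_kronecker]; simp
  conv => 
    enter [1, 1, 1]
    rw [h2]
  rw [ptrMid_cyc, ← h2]
  exact ptrMid_psd (hZ.mul_mul_conjTranspose_same _)

theorem ptrLeft_link_psd {S : Matrix α α ℂ} (hS : S.PosSemidef)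
    {Z : Matrix (α × β) (α × β) ℂ} (hZ : Z.PosSemidef) :
    (ptrLeft ((S ⊗ₖ (1 : Matrix β β ℂ)) * Z)).PosSemidef := by
  obtain ⟨C, rfl⟩ := psd_eq_mul hS
  have : ((Cᴴ * C) ⊗ₖ (1 : Matrix β β ℂ)) =
      (C ⊗ₖ (1 : Matrix β β ℂ))ᴴ * (C ⊗ₖ (1 : Matrix β β ℂ)) := by
    rw [Matrix.conjTranspose_kronecker, ← Matrix.mul_kronecker_mul]
    simp
  rw [this, mul_assoc]
  have h2 : (C ⊗ₖ (1 : Matrix β β ℂ))ᴴ = (Cᴴ ⊗ₖ (1 : Matrix β β ℂ)) := by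
    rw [Matrix.conjTranspose_kronecker]; simp
  conv => 
    enter [1, 1, 1]
    rw [h2]
  rw [ptrLeft_cyc, ← h2]
  exact ptrLeft_psd (hZ.mul_mul_conjTranspose_same _)

theorem ptrLeft_trace (M : Matrix α α ℂ) (N : Matrix β β ℂ) (Z : Matrix (α × β) (α × β) ℂ) :
    trace (ptrLeft ((M ⊗ₖ (1 : Matrix β β ℂ)) * Z) * N) = trace (Z * (M ⊗ₖ N)) := by
  have h1 : ∀ Y : Matrix (α × β) (α × β) ℂ,
      trace (ptrLeft Y * N) = trace (Y * ((1 : Matrix α α ℂ) ⊗ₖ N)) := by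
    intro Y
    simp only [Matrix.trace, Matrix.diag, ptrLeft, Matrix.mul_apply, Fintype.sum_prod_type,
      Matrix.kroneckerMap_apply, Matrix.one_apply]
    simp only [ite_mul, mul_ite, one_mul, zero_mul, mul_one, mul_zero, Finset.sum_ite_eq,
      Finset.sum_ite_eq', Finset.mem_univ, if_true, Finset.sum_ite_irrel, Finset.sum_const_zero,
      Finset.sum_mul]
    rw [Finset.sum_comm_cycle]
  rw [h1, mul_assoc, Matrix.trace_mul_comm, mul_assoc, ← Matrix.mul_kronecker_mul]
  simp

theorem ptrMid_trace (S : Matrix β β ℂ) (A : Matrix α α ℂ)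
    (Z : Matrix (α × β × γ) (α × β × γ) ℂ) :
    trace (ptrMid (((1 : Matrix α α ℂ) ⊗ₖ (S ⊗ₖ (1 : Matrix γ γ ℂ))) * Z) *
      (A ⊗ₖ (1 : Matrix γ γ ℂ))) = trace (Z * (A ⊗ₖ (S ⊗ₖ (1 : Matrix γ γ ℂ)))) := by
  have h1 : ∀ Y : Matrix (α × β × γ) (α × β × γ) ℂ,
      trace (ptrMid Y * (A ⊗ₖ (1 : Matrix γ γ ℂ))) =
        trace (Y * (A ⊗ₖ ((1 : Matrix β β ℂ) ⊗ₖ (1 : Matrix γ γ ℂ)))) := by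
    intro Y
    simp only [Matrix.trace, Matrix.diag, ptrMid, Matrix.mul_apply, Fintype.sum_prod_type,
      Matrix.kroneckerMap_apply, Matrix.one_apply]
    simp only [ite_mul, mul_ite, one_mul, zero_mul, mul_one, mul_zero, Finset.sum_ite_eq,
      Finset.sum_ite_eq', Finset.mem_univ, if_true, Finset.sum_ite_irrel, Finset.sum_const_zero,
      Finset.sum_mul]
    refine Finset.sum_congr rfl fun a _ => ?_
    rw [Finset.sum_comm_cycle]
  rw [h1, mul_assoc, Matrix.trace_mul_comm, mul_assoc, ← Matrix.mul_kronecker_mul,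
    ← Matrix.mul_kronecker_mul]
  simp

theorem comb1_iff (M : Matrix (α × γ) (α × γ) ℂ) (hM : M.PosSemidef) :
    M ∈ comb1Set α γ ↔ ∀ A : Matrix α α ℂ, A.IsHermitian →
      trace (M * (A ⊗ₖ (1 : Matrix γ γ ℂ))) = trace A := by
  let X : Matrix α α ℂ := fun a a' => ∑ b, M (a, b) (a', b)
  have hXdef : ∀ a a', X a a' = ∑ b, M (a, b) (a', b) := fun _ _ => rfl
  have hX : ∀ A, trace (M * (A ⊗ₖ (1 : Matrix γ γ ℂ))) = trace (X * A) := by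
    intro A
    simp only [hXdef, Matrix.trace, Matrix.diag, Matrix.mul_apply, Fintype.sum_prod_type,
      Matrix.kroneckerMap_apply, Matrix.one_apply]
    simp only [ite_mul, mul_ite, one_mul, zero_mul, mul_one, mul_zero, Finset.sum_ite_eq,
      Finset.sum_ite_eq', Finset.mem_univ, if_true, Finset.sum_ite_irrel, Finset.sum_const_zero,
      Finset.sum_mul]
    refine Finset.sum_congr rfl fun a _ => ?_
    rw [Finset.sum_comm]
  constructor
  · rintro ⟨-, h⟩ A hA
    rw [hX]
    have : X = 1 := h
    rw [this, one_mul]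
  · intro h
    refine ⟨hM, ?_⟩
    have hXh : X.IsHermitian := by
      ext a a'
      simp only [hXdef, Matrix.conjTranspose_apply, star_sum]
      exact Finset.sum_congr rfl fun b _ => hM.1.apply _ _
    have h2 := h (X - 1) (hXh.sub Matrix.isHermitian_one)
    rw [hX] at h2
    have h3 : trace ((X - 1)ᴴ * (X - 1)) = 0 := by
      rw [(hXh.sub Matrix.isHermitian_one).eq, sub_mul, one_mul, Matrix.trace_sub, h2, sub_self]
    have h4 := Matrix.trace_conjTranspose_mul_self_eq_zero_iff.mp h3
    exact sub_eq_zero.mp h4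

theorem trace_reindex_mul (e : α ≃ β) (X Y : Matrix α α ℂ) :
    trace (Matrix.reindex e e X * Matrix.reindex e e Y) = trace (X * Y) := by
  simp only [Matrix.reindex_apply, Matrix.submatrix_mul_equiv]
  simp only [Matrix.trace, Matrix.diag, Matrix.submatrix_apply]
  exact Equiv.sum_comp e.symm (fun i => (X * Y) i i)

theorem reindex_psd (e : α ≃ β) {X : Matrix α α ℂ} (h : X.PosSemidef) :
    (Matrix.reindex e e X).PosSemidef := h.submatrix _

end PSDlemmas

theorem TT_split (a b : ℕ) (H : ℕ → Type) (A : ∀ j, Matrix (H j) (H j) ℂ) :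
    Matrix.reindex (splitPi a b H) (splitPi a b H) (TT (a + b) H A) =
      TT a H A ⊗ₖ TT b (fun i => H (a + i)) (fun i => A (a + i)) := by
  have : TT (a + b) H A = (TT a H A ⊗ₖ TT b (fun i => H (a + i)) (fun i => A (a + i))).submatrix
      (splitPi a b H) (splitPi a b H) := by
    ext x y
    simp only [TT, Matrix.submatrix_apply, Matrix.kroneckerMap_apply]
    rw [Fin.prod_univ_add]
    rfl
  rw [this]
  simp [Matrix.reindex_apply]

theorem TT_ends (k : ℕ) (H : ℕ → Type) (A : ∀ j, Matrix (H j) (H j) ℂ) :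
    Matrix.reindex (splitEnds H k) (splitEnds H k) (TT (k + 2) H A) =
      A 0 ⊗ₖ (TT k (fun i => H (i + 1)) (fun i => A (i + 1)) ⊗ₖ A (k + 1)) := by
  have : TT (k + 2) H A =
      (A 0 ⊗ₖ (TT k (fun i => H (i + 1)) (fun i => A (i + 1)) ⊗ₖ A (k + 1))).submatrix
      (splitEnds H k) (splitEnds H k) := by
    ext x y
    simp only [TT, Matrix.submatrix_apply, Matrix.kroneckerMap_apply]
    rw [Fin.prod_univ_succ, Fin.prod_univ_castSucc]
    rfl
  rw [this]
  simp [Matrix.reindex_apply]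

theorem cast_fam {H : ℕ → Type} (C : ∀ j, Matrix (H j) (H j) ℂ) {a b : ℕ} (h : a = b)
    (h' : H a = H b) (u v : H a) : C b (cast h' u) (cast h' v) = C a u v := by
  subst h; rfl

theorem TT_perm (H : ℕ → Type) {q q' : ℕ} (σ : Equiv.Perm (Fin q)) (h : q = q')
    (C : ∀ j, Matrix (H j) (H j) ℂ) :
    Matrix.reindex ((permEquiv H σ).trans (piFinCast (fun i => H (extendPerm σ i)) h))
      ((permEquiv H σ).trans (piFinCast (fun i => H (extendPerm σ i)) h)) (TT q H C) =
      TT q' (fun i => H (extendPerm σ i)) (fun i => C (extendPerm σ i)) := by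
  subst h
  have : TT q H C = (TT q (fun i => H (extendPerm σ i)) (fun i => C (extendPerm σ i))).submatrix
      ((permEquiv H σ).trans (piFinCast (fun i => H (extendPerm σ i)) rfl))
      ((permEquiv H σ).trans (piFinCast (fun i => H (extendPerm σ i)) rfl)) := by
    ext x y
    simp only [TT, Matrix.submatrix_apply]
    rw [← Equiv.prod_comp σ]
    refine Finset.prod_congr rfl fun j _ => ?_
    have hj : ((σ j : Fin q) : ℕ) = extendPerm σ j := by simp [extendPerm]
    exact (cast_fam C hj (congrArg H hj) (x (σ j)) (y (σ j))).symm
  rw [this]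
  rw [Matrix.reindex_apply, Matrix.submatrix_submatrix, Equiv.self_comp_symm, Matrix.submatrix_id_id]

def LastAt (q : ℕ) (H : ℕ → Type) [∀ j, Fintype (H j)] [∀ j, DecidableEq (H j)]
    (A : ∀ j, Matrix (H j) (H j) ℂ) (k : ℕ) : Prop :=
  k < q ∧ (∀ j < q, (A j).IsHermitian) ∧ trace (A k) = 0 ∧ ∀ j, k < j → j < q → A j = 1

def dE (q : ℕ) (H : ℕ → Type) [∀ j, Fintype (H j)] : ℝ :=
  ∏ j ∈ Finset.range q, if Even j then (Fintype.card (H j) : ℝ) else 1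

def dAll (q : ℕ) (H : ℕ → Type) [∀ j, Fintype (H j)] : ℝ :=
  ∏ j ∈ Finset.range q, (Fintype.card (H j) : ℝ)

def Kill (q : ℕ) (H : ℕ → Type) [∀ j, Fintype (H j)] [∀ j, DecidableEq (H j)]
    (R : Matrix (∀ j : Fin q, H j) (∀ j : Fin q, H j) ℂ) : Prop :=
  ∀ (A : ∀ j, Matrix (H j) (H j) ℂ) (k : ℕ), Even k → LastAt q H A k → trace (R * TT q H A) = 0

def Cond (q : ℕ) (H : ℕ → Type) [∀ j, Fintype (H j)] [∀ j, DecidableEq (H j)]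
    (R : Matrix (∀ j : Fin q, H j) (∀ j : Fin q, H j) ℂ) : Prop :=
  trace R = (dE q H : ℂ) ∧ Kill q H R

def AL (q : ℕ) (H : ℕ → Type) [∀ j, Fintype (H j)] [∀ j, DecidableEq (H j)] :
    Set (Matrix (∀ j : Fin q, H j) (∀ j : Fin q, H j) ℂ) :=
  {X | ∃ A, X = TT q H A ∧ ∃ k, Odd k ∧ LastAt q H A k}

theorem class_string (p : ℕ → Prop) (q : ℕ) :
    (∀ j < q, ¬ p j) ∨ ∃ k < q, p k ∧ ∀ j, k < j → j < q → ¬ p j := by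
  induction q with
  | zero => left; intro j hj; omega
  | succ q ih =>
    by_cases h : p q
    · right; exact ⟨q, by omega, h, fun j h1 h2 => by omega⟩
    · rcases ih with h1 | ⟨k, hk, hp, hj⟩
      · left; intro j hj
        rcases Nat.lt_succ_iff_lt_or_eq.mp hj with h2 | h2
        · exact h1 j h2
        · rwa [h2]
      · right; refine ⟨k, by omega, hp, fun j h1 h2 => ?_⟩
        rcases Nat.lt_succ_iff_lt_or_eq.mp h2 with h3 | h3
        · exact hj j h1 h3
        · rwa [h3]

section CombChar
variable {q : ℕ} {H : ℕ → Type} [∀ j, Fintype (H j)] [∀ j, DecidableEq (H j)]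

theorem trace_one_dAll : trace (1 : Matrix (∀ j : Fin q, H j) (∀ j : Fin q, H j) ℂ) = (dAll q H : ℂ) := by
  rw [Matrix.trace_one, Fintype.card_pi, dAll, Finset.prod_range]
  push_cast; rfl

theorem dE_pos (hne : ∀ j < q, Nonempty (H j)) : 0 < dE q H := by
  refine Finset.prod_pos fun j hj => ?_
  have := hne j (Finset.mem_range.mp hj)
  split_ifs
  · exact_mod_cast Fintype.card_pos
  · norm_num

theorem dAll_pos (hne : ∀ j < q, Nonempty (H j)) : 0 < dAll q H := by
  refine Finset.prod_pos fun j hj => ?_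
  have := hne j (Finset.mem_range.mp hj)
  exact_mod_cast Fintype.card_pos

theorem kill_span {R : Matrix (∀ j : Fin q, H j) (∀ j : Fin q, H j) ℂ} (h : Kill q H R) :
    R ∈ Submodule.span ℂ ({1} ∪ AL q H) := by
  refine Submodule.span_mono ?_ (decomp R)
  rintro _ ⟨s, A, hA, rfl, A', hA', hne⟩
  rcases class_string (fun j => j ∈ s) q with h0 | ⟨k, hk, hks, hj⟩
  · left
    rw [Set.mem_singleton_iff, ← TT_one]
    exact TT_congr fun j hj => (hA.2 j hj).2.2 (h0 j hj)
  · have last : ∀ B, PureF q H s B → LastAt q H B k := fun B hB =>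
      ⟨hk, fun j h => (hB.2 j h).1, (hB.2 k hk).2.1 hks, fun j h1 h2 => (hB.2 j h2).2.2 (hj j h1 h2)⟩
    rcases Nat.even_or_odd k with he | ho
    · exact absurd (h A' k he (last A' hA')) hne
    · right; exact ⟨A, rfl, k, ho, last A hA⟩

theorem AL_kill {X : Matrix (∀ j : Fin q, H j) (∀ j : Fin q, H j) ℂ}
    (hX : X ∈ Submodule.span ℂ (AL q H)) : Kill q H X := by
  intro A k hk hA
  rw [Matrix.trace_mul_comm]
  refine trace_pair_zero_of_span hX ?_
  rintro _ ⟨B, rfl, l, hl, hB⟩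
  rcases lt_trichotomy k l with h | h | h
  · refine TT_pair_zero hB.1 ?_
    rw [hA.2.2.2 l h hB.1, one_mul]; exact hB.2.2.1
  · subst h; exact absurd hl (Nat.not_odd_iff_even.mpr hk)
  · refine TT_pair_zero hA.1 ?_
    rw [hB.2.2.2 k h hA.1, mul_one]; exact hA.2.2.1

theorem AL_trace {X : Matrix (∀ j : Fin q, H j) (∀ j : Fin q, H j) ℂ}
    (hX : X ∈ Submodule.span ℂ (AL q H)) : trace X = 0 := by
  have := trace_pair_zero_of_span (R := 1) hX ?_
  · simpa using this
  · rintro _ ⟨B, rfl, l, hl, hB⟩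
    rw [one_mul]; exact TT_trace_zero hB.1 hB.2.2.1

theorem cond_interior (hne : ∀ j < q, Nonempty (H j))
    {X : Matrix (∀ j : Fin q, H j) (∀ j : Fin q, H j) ℂ} (hXh : X.IsHermitian)
    (hX : X ∈ Submodule.span ℂ (AL q H)) :
    ∃ ε : ℝ, 0 < ε ∧
      (((dE q H / dAll q H : ℝ) : ℂ) • (1 : Matrix _ _ ℂ) + (ε : ℂ) • X).PosSemidef ∧
      Cond q H (((dE q H / dAll q H : ℝ) : ℂ) • (1 : Matrix _ _ ℂ) + (ε : ℂ) • X) := by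
  have hA := dAll_pos hne
  obtain ⟨ε, hε, hpsd⟩ := psd_perturb hXh (div_pos (dE_pos hne) hA)
  refine ⟨ε, hε, hpsd, ?_, ?_⟩
  · rw [Matrix.trace_add, Matrix.trace_smul, Matrix.trace_smul, AL_trace hX, trace_one_dAll,
      smul_zero, add_zero, smul_eq_mul]
    have : (dAll q H : ℂ) ≠ 0 := by exact_mod_cast hA.ne'
    push_cast
    field_simp
  · intro A k hk hl
    rw [add_mul, smul_mul_assoc, smul_mul_assoc, one_mul, Matrix.trace_add, Matrix.trace_smul,
      Matrix.trace_smul, AL_kill hX A k hk hl, TT_trace_zero hl.1 hl.2.2.1]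
    simp

theorem comb_step (p : ℕ) (hp : Even p) (hne : ∀ j < p + 2, Nonempty (H j))
    (SS : Set (Matrix (∀ j : Fin p, H (j + 1)) (∀ j : Fin p, H (j + 1)) ℂ))
    (hSS : ∀ S, S ∈ SS ↔ S.PosSemidef ∧ Cond p (fun i => H (i + 1)) S)
    (R : Matrix (∀ j : Fin (p + 2), H j) (∀ j : Fin (p + 2), H j) ℂ) (hR : R.PosSemidef) :
    (∀ S ∈ SS, ptrMid (((1 : Matrix (H 0) (H 0) ℂ) ⊗ₖ
          (S ⊗ₖ (1 : Matrix (H (p + 1)) (H (p + 1)) ℂ))) *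
        (Matrix.reindex (splitEnds H p) (splitEnds H p) R)) ∈
      comb1Set (H 0) (H (p + 1))) ↔ Cond (p + 2) H R := by
  have hne' : ∀ j < p, Nonempty (H (j + 1)) := fun j hj => hne _ (by omega)
  have hR' := reindex_psd (splitEnds H p) hR
  set R' := Matrix.reindex (splitEnds H p) (splitEnds H p) R with hR'def
  let L : Matrix (H 0) (H 0) ℂ → Matrix (∀ j : Fin p, H (j + 1)) (∀ j : Fin p, H (j + 1)) ℂ → ℂ :=
    fun A S => trace (R' * (A ⊗ₖ (S ⊗ₖ (1 : Matrix (H (p + 1)) (H (p + 1)) ℂ))))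
  have Ladd : ∀ A S T, L A (S + T) = L A S + L A T := by
    intro A S T
    simp only [L, Matrix.add_kronecker, Matrix.kronecker_add, mul_add, Matrix.trace_add]
  have Lsmul : ∀ A (c : ℂ) S, L A (c • S) = c * L A S := by
    intro A c S
    simp only [L, Matrix.smul_kronecker, Matrix.kronecker_smul, mul_smul_comm, Matrix.trace_smul,
      smul_eq_mul]
  have LTT : ∀ C : ∀ j, Matrix (H j) (H j) ℂ, C (p + 1) = 1 →
      trace (R * TT (p + 2) H C) = L (C 0) (TT p (fun i => H (i + 1)) (fun i => C (i + 1))) := by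
    intro C hC
    rw [← trace_reindex_mul (splitEnds H p), TT_ends, hC]
  have hmem : (∀ S ∈ SS, ptrMid (((1 : Matrix (H 0) (H 0) ℂ) ⊗ₖ
          (S ⊗ₖ (1 : Matrix (H (p + 1)) (H (p + 1)) ℂ))) * R') ∈ comb1Set (H 0) (H (p + 1))) ↔
      ∀ S, S.PosSemidef → Cond p (fun i => H (i + 1)) S → ∀ A : Matrix (H 0) (H 0) ℂ,
        A.IsHermitian → L A S = trace A := by
    constructor
    · intro h S h1 h2 A hA
      have := (comb1_iff _ (ptrMid_link_psd h1 hR')).mp (h S ((hSS S).mpr ⟨h1, h2⟩)) A hA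
      rwa [ptrMid_trace] at this
    · intro h S hS
      have h1 := (hSS S).mp hS
      rw [comb1_iff _ (ptrMid_link_psd h1.1 hR')]
      intro A hA
      rw [ptrMid_trace]
      exact h S h1.1 h1.2 A hA
  rw [hmem]
  have hEpos := dE_pos hne'
  have hApos := dAll_pos hne'
  set e := dE p (fun i => H (i + 1)) with he
  set d := dAll p (fun i => H (i + 1)) with hd
  have h0 := hne 0 (by omega)
  have hd0 : (0 : ℝ) < Fintype.card (H 0) := by exact_mod_cast Fintype.card_pos
  have hdim : dE (p + 2) H * e = Fintype.card (H 0) * d := by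
    rw [he, hd, dE, dE, dAll, Finset.prod_range_succ, Finset.prod_range_succ', if_pos (by simp),
      if_neg (by rw [Nat.not_even_iff_odd]; exact hp.add_one), mul_one, mul_right_comm,
      ← Finset.prod_mul_distrib, mul_comm]
    congr 1
    refine Finset.prod_congr rfl fun j _ => ?_
    by_cases h : Even j
    · rw [if_neg (by rw [Nat.not_even_iff_odd]; exact h.add_one), if_pos h, one_mul]
    · rw [if_pos ((Nat.not_even_iff_odd.mp h).add_one), if_neg h, mul_one]
  have hec : (e : ℂ) ≠ 0 := by exact_mod_cast hEpos.ne'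
  have hdc : (d : ℂ) ≠ 0 := by exact_mod_cast hApos.ne'
  have hd0c : (Fintype.card (H 0) : ℂ) ≠ 0 := by exact_mod_cast hd0.ne'
  have hdimc : (dE (p + 2) H : ℂ) * e = Fintype.card (H 0) * d := by exact_mod_cast hdim
  have hL11 : L 1 1 = trace R := by
    have := LTT (fun _ => 1) rfl
    rw [TT_one, TT_one, mul_one] at this
    exact this.symm
  constructor
  · intro h
    have hX : ∀ X : Matrix (∀ j : Fin p, H (j + 1)) (∀ j : Fin p, H (j + 1)) ℂ, X.IsHermitian →
        X ∈ Submodule.span ℂ (AL p (fun i => H (i + 1))) → ∀ A : Matrix (H 0) (H 0) ℂ,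
        A.IsHermitian → L A 1 = trace A * d / e ∧ L A X = 0 := by
      have h1 : ∀ A : Matrix (H 0) (H 0) ℂ, A.IsHermitian → L A 1 = trace A * d / e := by
        intro A hA
        obtain ⟨ε, hε, h1, h2⟩ := cond_interior hne' (X := 0) Matrix.isHermitian_zero
          (Submodule.zero_mem _)
        rw [smul_zero, add_zero] at h1 h2
        have := h _ h1 h2 A hA
        rw [Lsmul] at this
        push_cast at this
        rw [← this, ← he, ← hd]
        field_simp
      intro X hXh hXs A hA
      refine ⟨h1 A hA, ?_⟩
      obtain ⟨ε, hε, h3, h4⟩ := cond_interior hne' hXh hXs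
      have := h _ h3 h4 A hA
      rw [Ladd, Lsmul, Lsmul, h1 A hA] at this
      have hεc : (ε : ℂ) ≠ 0 := by exact_mod_cast hε.ne'
      push_cast at this
      rw [← he, ← hd] at this
      have h5 : (e : ℂ) / d * (trace A * d / e) = trace A := by field_simp
      rw [h5] at this
      have h6 : (ε : ℂ) * L A X = 0 := by linear_combination this
      exact (mul_eq_zero.mp h6).resolve_left hεc
    have h1 : ∀ A : Matrix (H 0) (H 0) ℂ, A.IsHermitian → L A 1 = trace A * d / e := fun A hA =>
      (hX 0 Matrix.isHermitian_zero (Submodule.zero_mem _) A hA).1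
    refine ⟨?_, ?_⟩
    · rw [← hL11, h1 1 Matrix.isHermitian_one, Matrix.trace_one, ← hdimc]
      field_simp
    · intro A k hk hA
      have hk1 : k < p + 1 := by
        rcases hA.1 with h'
        rcases Nat.lt_or_ge k (p + 1) with h | h
        · exact h
        · have : k = p + 1 := by omega
          subst this
          exact absurd hk (by rw [Nat.not_even_iff_odd]; exact hp.add_one)
      rw [LTT A (hA.2.2.2 _ hk1 (by omega))]
      rcases Nat.eq_zero_or_pos k with h | h
      · subst h
        have : TT p (fun i => H (i + 1)) (fun i => A (i + 1)) = 1 := by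
          exact (TT_congr (fun j hj => hA.2.2.2 _ (by omega) (by omega))).trans
            (TT_one (q := p) (H := fun i => H (i + 1)))
        rw [this, h1 _ (hA.2.1 0 (by omega)), hA.2.2.1]
        simp
      · obtain ⟨l, rfl⟩ : ∃ l, k = l + 1 := ⟨k - 1, by omega⟩
        have hhh : ∀ j < p, ((fun i => A (i + 1)) j).IsHermitian := fun j hj => hA.2.1 _ (by omega)
        refine (hX _ (TT_herm hhh) (Submodule.subset_span ⟨_, rfl, l, ?_, ?_⟩) _
          (hA.2.1 0 (by omega))).2
        · exact Nat.not_even_iff_odd.mp fun h => by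
            rw [Nat.even_add_one] at hk; exact hk h
        · exact ⟨by omega, hhh, hA.2.2.1, fun j h1 h2 => hA.2.2.2 _ (by omega) (by omega)⟩
  · rintro ⟨htr, hkill⟩ S hS hSc A hA
    have hLA1 : L A 1 = trace A / Fintype.card (H 0) * trace R := by
      set t : ℂ := trace A / Fintype.card (H 0) with ht
      have htA : star (trace A) = trace A := by rw [← Matrix.trace_conjTranspose, hA.eq]
      have hst : star t = t := by rw [ht, star_div₀, htA]; simp
      have := hkill (fun j => Nat.casesOn j (A - t • 1) (fun _ => 1)) 0 (by simp)
        ⟨by omega, ?_, ?_, ?_⟩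
      · rw [LTT _ rfl] at this
        change L (A - t • 1) (TT p (fun i => H (i + 1)) (fun _ => 1)) = 0 at this
        rw [TT_one] at this
        have h2 : L (A - t • 1) 1 = L A 1 - t * L 1 1 := by
          simp only [L, sub_eq_add_neg, ← neg_smul, Matrix.add_kronecker, Matrix.smul_kronecker, mul_add,
            Matrix.trace_add, mul_smul_comm, Matrix.trace_smul, smul_eq_mul]
          ring
        rw [h2, hL11] at this
        linear_combination this
      · intro j _
        cases j with
        | zero =>
          change (A - t • 1).IsHermitian
          rw [Matrix.IsHermitian, Matrix.conjTranspose_sub, Matrix.conjTranspose_smul, hst, hA.eq]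
          simp
        | succ j => exact Matrix.isHermitian_one
      · change trace (A - t • 1) = 0
        rw [Matrix.trace_sub, Matrix.trace_smul, Matrix.trace_one, ht, smul_eq_mul]
        field_simp
        simp
      · intro j h1 h2
        cases j with
        | zero => omega
        | succ j => rfl
    have hLS : ∀ X, X ∈ Submodule.span ℂ ({1} ∪ AL p (fun i => H (i + 1))) →
        L A X = L A 1 / d * trace X := by
      intro X hX
      clear hS hSc
      induction hX using Submodule.span_induction with
      | mem X hX =>
        rcases hX with hX | ⟨B, rfl, k, hk, hB⟩
        · rw [Set.mem_singleton_iff] at hX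
          subst hX
          have h1 : trace (1 : Matrix (∀ j : Fin p, H (j + 1)) (∀ j : Fin p, H (j + 1)) ℂ) = (d : ℂ) :=
            trace_one_dAll (q := p) (H := fun i => H (i + 1))
          rw [h1]
          field_simp
        · rw [TT_trace_zero hB.1 hB.2.2.1, mul_zero]
          have := hkill (fun j => Nat.casesOn j A (fun i => if i < p then B i else 1)) (k + 1)
            hk.add_one ⟨by have := hB.1; omega, ?_, ?_, ?_⟩
          · rw [LTT _ (by simp)] at this
            change L A (TT p (fun i => H (i + 1)) (fun i => if i < p then B i else 1)) = 0 at this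
            rwa [TT_congr (B := B) (fun j hj => by simp [hj])] at this
          · intro j hj
            cases j with
            | zero => exact hA
            | succ j =>
              change (if j < p then B j else 1).IsHermitian
              split_ifs with h
              · exact hB.2.1 j h
              · exact Matrix.isHermitian_one
          · change trace (if k < p then B k else 1) = 0
            rw [if_pos hB.1]; exact hB.2.2.1
          · intro j h1 h2
            cases j with
            | zero => omega
            | succ j =>
              change (if j < p then B j else 1) = 1
              split_ifs with h
              · exact hB.2.2.2 j (by omega) h
              · rfl
      | zero => 
        have := Lsmul A 0 0
        rw [smul_zero, zero_mul] at this
        rw [this]; simp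
      | add X Y _ _ h1 h2 => rw [Ladd, h1, h2, Matrix.trace_add]; ring
      | smul a X _ h1 => rw [Lsmul, h1, Matrix.trace_smul, smul_eq_mul]; ring
    rw [hLS S (kill_span hSc.2), hLA1, htr, hSc.1, ← he]
    field_simp
    linear_combination (trace A) * hdimc
end CombChar

theorem comb_iff (n : ℕ) : ∀ (H : ℕ → Type) [∀ j, Fintype (H j)] [∀ j, DecidableEq (H j)]
    (_ : ∀ j < 2 * (n + 1), Nonempty (H j))
    (R : Matrix (∀ j : Fin (2 * (n + 1)), H j) (∀ j : Fin (2 * (n + 1)), H j) ℂ),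
    R ∈ Comb (n + 1) H ↔ R.PosSemidef ∧ Cond (2 * (n + 1)) H R := by
  induction n with
  | zero =>
    intro H _ _ hne R
    have key : ∀ (R : Matrix (∀ j : Fin (0 + 2), H j) (∀ j : Fin (0 + 2), H j) ℂ),
        R.PosSemidef → (trLast 1 R = (1 : Matrix (∀ j : Fin 1, H j) (∀ j : Fin 1, H j) ℂ) ↔
          Cond (0 + 2) H R) := by
      intro R hR
      rw [← comb_step 0 (by simp) hne {1} ?_ R hR]
      · simp only [Set.mem_singleton_iff, forall_eq]
        rw [Matrix.one_kronecker_one, Matrix.one_kronecker_one, one_mul]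
        let emb : H 0 → (∀ j : Fin 1, H j) := fun a j =>
          cast (congrArg H (by have := j.isLt; omega : 0 = (j : ℕ))) a
        have e : ∀ a a' : H 0, (∑ b, ptrMid (Matrix.reindex (splitEnds H 0) (splitEnds H 0) R)
            (a, b) (a', b)) = trLast 1 R (emb a) (emb a') := by
          intro a a'
          simp only [ptrMid, trLast, Fintype.sum_unique]
          refine Finset.sum_congr rfl fun b _ => ?_
          rw [Matrix.reindex_apply, Matrix.submatrix_apply]
          have hx : ∀ (a : H 0), (splitEnds H 0).symm (a, default, b) =
              (Fin.snoc (α := fun j : Fin 2 => H j) (emb a) b) := by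
            intro a
            rw [Equiv.symm_apply_eq]
            refine Prod.ext ?_ (Prod.ext ?_ ?_)
            · rfl
            · exact Subsingleton.elim _ _
            · rfl
          rw [hx, hx]
        constructor
        · intro h
          refine ⟨ptrMid_psd (reindex_psd _ hR), ?_⟩
          ext a a'
          rw [e, h, Matrix.one_apply, Matrix.one_apply]
          congr 1
          simp only [eq_iff_iff]
          constructor
          · intro h; exact congrFun h 0
          · rintro rfl; rfl
        · rintro ⟨-, h⟩
          ext x y
          have h1 := congrFun (congrFun h (x 0)) (y 0)
          rw [e] at h1
          have hx : ∀ x : (∀ j : Fin 1, H j),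
              emb (x 0) = x := by
            intro x; funext j
            have : j = 0 := Subsingleton.elim _ _
            subst this; rfl
          rw [hx, hx] at h1
          rw [h1, Matrix.one_apply, Matrix.one_apply]
          congr 1
          simp only [eq_iff_iff]
          constructor
          · intro h; rw [← hx x, ← hx y, h]
          · rintro rfl; rfl
      · intro S
        rw [Set.mem_singleton_iff]
        have hdE : dE 0 (fun i => H (i + 1)) = 1 := by simp [dE]
        constructor
        · rintro rfl
          refine ⟨Matrix.PosSemidef.one, ?_, ?_⟩
          · rw [hdE]; simp
          · intro A k _ hA
            exact absurd hA.1 (by omega)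
        · rintro ⟨-, h, -⟩
          rw [hdE] at h
          ext x y
          rw [Subsingleton.elim y x, Matrix.one_apply_eq]
          rw [Matrix.trace, Fintype.sum_unique, Subsingleton.elim default x] at h
          simpa using h
    constructor
    · rintro ⟨h1, h2⟩
      exact ⟨h1, (key R h1).mp h2⟩
    · rintro ⟨h1, h2⟩
      exact ⟨h1, (key R h1).mpr h2⟩
  | succ n ih =>
    intro H _ _ hne R
    have key := fun hR => comb_step (H := H) (2 * (n + 1)) (by simp) hne (Comb (n + 1) (fun m => H (m + 1)))
      (fun S => ih (fun m => H (m + 1)) (fun j hj => hne _ (by omega)) S) R hR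
    constructor
    · rintro ⟨h1, h2⟩
      exact ⟨h1, (key h1).mp h2⟩
    · rintro ⟨h1, h2⟩
      exact ⟨h1, (key h1).mpr h2⟩

theorem comb_iff' {n : ℕ} (hn : 1 ≤ n) (H : ℕ → Type) [∀ j, Fintype (H j)] [∀ j, DecidableEq (H j)]
    (hne : ∀ j < 2 * n, Nonempty (H j))
    (R : Matrix (∀ j : Fin (2 * n), H j) (∀ j : Fin (2 * n), H j) ℂ) :
    R ∈ Comb n H ↔ R.PosSemidef ∧ Cond (2 * n) H R := by
  obtain ⟨n, rfl⟩ : ∃ k, n = k + 1 := ⟨n - 1, by omega⟩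
  exact comb_iff n H hne R

/-- Joining of two families of matrices. -/
theorem join_fam (a : ℕ) (H : ℕ → Type) (A : ∀ j, Matrix (H j) (H j) ℂ)
    (B : ∀ i, Matrix (H (a + i)) (H (a + i)) ℂ) :
    ∃ C : ∀ j, Matrix (H j) (H j) ℂ, (∀ j < a, C j = A j) ∧ ∀ i, C (a + i) = B i := by
  have : ∀ j, ∃ X : Matrix (H j) (H j) ℂ, (j < a → X = A j) ∧
      ∀ i, ∀ h : a + i = j, X = h ▸ B i := by
    intro j
    by_cases h : j < a
    · exact ⟨A j, fun _ => rfl, fun i hi => by omega⟩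
    · obtain ⟨i, rfl⟩ := Nat.exists_eq_add_of_le (Nat.le_of_not_lt h)
      refine ⟨B i, fun h => by omega, fun i' hi' => ?_⟩
      have : i' = i := by omega
      subst this; rfl
  choose C h1 h2 using this
  exact ⟨C, fun j hj => h1 j hj, fun i => h2 (a + i) i rfl⟩

section PermK
variable {q : ℕ} {H : ℕ → Type} [∀ j, Fintype (H j)] [∀ j, DecidableEq (H j)]

def PLast (q : ℕ) (H : ℕ → Type) [∀ j, Fintype (H j)] [∀ j, DecidableEq (H j)] (π : ℕ → ℕ)
    (C : ∀ j, Matrix (H j) (H j) ℂ) (j0 : ℕ) : Prop :=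
  j0 < q ∧ (∀ j < q, (C j).IsHermitian) ∧ trace (C j0) = 0 ∧ ∀ j < q, π j0 < π j → C j = 1

def IsInv (σ : Equiv.Perm (Fin q)) (π : ℕ → ℕ) : Prop :=
  ∀ j (hj : j < q), (σ.symm ⟨j, hj⟩ : ℕ) = π j

theorem inv_lt {σ : Equiv.Perm (Fin q)} {π : ℕ → ℕ} (h : IsInv σ π) {j : ℕ} (hj : j < q) :
    π j < q := by rw [← h j hj]; exact Fin.isLt _

theorem ext_inv {σ : Equiv.Perm (Fin q)} {π : ℕ → ℕ} (h : IsInv σ π) {j : ℕ} (hj : j < q) :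
    extendPerm σ (π j) = j := by
  rw [extendPerm, dif_pos (inv_lt h hj)]
  have : (⟨π j, inv_lt h hj⟩ : Fin q) = σ.symm ⟨j, hj⟩ := Fin.ext (h j hj).symm
  rw [this, Equiv.apply_symm_apply]

theorem ext_lt (σ : Equiv.Perm (Fin q)) {j : ℕ} (hj : j < q) : extendPerm σ j < q := by
  rw [extendPerm, dif_pos hj]; exact Fin.isLt _

theorem inv_ext {σ : Equiv.Perm (Fin q)} {π : ℕ → ℕ} (h : IsInv σ π) {j : ℕ} (hj : j < q) :
    π (extendPerm σ j) = j := by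
  rw [extendPerm, dif_pos hj, ← h _ (Fin.isLt _)]
  simp

theorem plast_last {σ : Equiv.Perm (Fin q)} {π : ℕ → ℕ} (h : IsInv σ π) {q' : ℕ} (hq : q = q')
    {C : ∀ j, Matrix (H j) (H j) ℂ} {j0 : ℕ} (hC : PLast q H π C j0) :
    LastAt q' (fun i => H (extendPerm σ i)) (fun i => C (extendPerm σ i)) (π j0) := by
  subst hq
  refine ⟨inv_lt h hC.1, fun j hj => hC.2.1 _ (ext_lt σ hj), ?_, fun j h1 h2 => ?_⟩
  · have : ∀ j, j = j0 → trace (C j) = 0 := by rintro _ rfl; exact hC.2.2.1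
    exact this _ (ext_inv h hC.1)
  · exact hC.2.2.2 _ (ext_lt σ h2) (by rwa [inv_ext h h2])

/-- The tensors of families whose last nontrivial position (after permuting) is odd. -/
def ALP (q : ℕ) (H : ℕ → Type) [∀ j, Fintype (H j)] [∀ j, DecidableEq (H j)] (π : ℕ → ℕ) :
    Set (Matrix (∀ j : Fin q, H j) (∀ j : Fin q, H j) ℂ) :=
  {X | ∃ C, X = TT q H C ∧ ∃ j0, Odd (π j0) ∧ PLast q H π C j0}

def KS {N : ℕ} (H : ℕ → Type) [∀ j, Fintype (H j)] [∀ j, DecidableEq (H j)]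
    (σ : Equiv.Perm (Fin q)) (hq : q = 2 * N) :
    Set (Matrix (∀ j : Fin q, H j) (∀ j : Fin q, H j) ℂ) :=
  {R | R.PosSemidef ∧
    Matrix.reindex ((permEquiv H σ).trans (piFinCast (fun i => H (extendPerm σ i)) hq))
      ((permEquiv H σ).trans (piFinCast (fun i => H (extendPerm σ i)) hq)) R ∈
        Comb N (fun i => H (extendPerm σ i))}

theorem dAll_perm (σ : Equiv.Perm (Fin q)) {q' : ℕ} (hq : q = q') :
    dAll q' (fun i => H (extendPerm σ i)) = dAll q H := by
  have h1 := trace_one_dAll (q := q') (H := fun i => H (extendPerm σ i))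
  have h2 := trace_one_dAll (q := q) (H := H)
  rw [Matrix.trace_one, ← Fintype.card_congr
    ((permEquiv H σ).trans (piFinCast (fun i => H (extendPerm σ i)) hq)), ← Matrix.trace_one (R := ℂ), h2] at h1
  exact_mod_cast h1.symm

theorem dE_perm {σ : Equiv.Perm (Fin q)} {π : ℕ → ℕ} (h : IsInv σ π) {q' : ℕ} (hq : q = q') :
    dE q' (fun i => H (extendPerm σ i)) =
      ∏ j ∈ Finset.range q, if Even (π j) then (Fintype.card (H j) : ℝ) else 1 := by
  subst hq
  rw [dE, Finset.prod_range, Finset.prod_range]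
  refine Eq.trans ?_ (Equiv.prod_comp σ
    (fun j : Fin q => if Even (π j) then (Fintype.card (H j) : ℝ) else 1))
  refine Finset.prod_congr rfl fun j _ => ?_
  have : extendPerm σ j = σ j := by rw [extendPerm, dif_pos j.isLt]
  rw [← this, inv_ext h j.isLt]

theorem dE_perm' {a b : ℕ} {σ : Equiv.Perm (Fin (a + b))} {π : ℕ → ℕ} (h : IsInv σ π) {q' : ℕ}
    (hq : a + b = q') (h1 : ∀ j < a, Even (π j) ↔ ¬ Even j)
    (h2 : ∀ j < b, Even (π (a + j)) ↔ Even j) :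
    dE q' (fun i => H (extendPerm σ i)) * dE a H = dE b (fun i => H (a + i)) * dAll a H := by
  rw [dE_perm h hq, Finset.prod_range_add, mul_right_comm, mul_comm, dE, dE, dAll]
  congr 1
  · exact Finset.prod_congr rfl fun j hj => by simp only [h2 j (Finset.mem_range.mp hj)]
  · rw [← Finset.prod_mul_distrib]
    refine Finset.prod_congr rfl fun j hj => ?_
    simp only [h1 j (Finset.mem_range.mp hj)]
    split_ifs <;> simp

variable {N : ℕ} {σ : Equiv.Perm (Fin q)} {π : ℕ → ℕ}

theorem ext_ne (σ : Equiv.Perm (Fin q)) (hq : q = 2 * N) (hne : ∀ j < q, Nonempty (H j)) :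
    ∀ j < 2 * N, Nonempty (H (extendPerm σ j)) := fun j hj => hne _ (ext_lt σ (by omega))

theorem K_kill (hN : 1 ≤ N) (h : IsInv σ π) (hq : q = 2 * N) (hne : ∀ j < q, Nonempty (H j))
    {R : Matrix (∀ j : Fin q, H j) (∀ j : Fin q, H j) ℂ} (hR : R ∈ KS H σ hq)
    {C : ∀ j, Matrix (H j) (H j) ℂ} {j0 : ℕ} (hC : PLast q H π C j0) (hj0 : Even (π j0)) :
    trace (R * TT q H C) = 0 := by
  have h1 := ((comb_iff' hN _ (ext_ne σ hq hne) _).mp hR.2).2.2 _ _ hj0 (plast_last h hq hC)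
  rw [← TT_perm H σ hq C, trace_reindex_mul] at h1
  exact h1

theorem K_trace (hN : 1 ≤ N) (hq : q = 2 * N) (hne : ∀ j < q, Nonempty (H j))
    {R : Matrix (∀ j : Fin q, H j) (∀ j : Fin q, H j) ℂ} (hR : R ∈ KS H σ hq) :
    trace R = (dE (2 * N) (fun i => H (extendPerm σ i)) : ℂ) := by
  have h1 := ((comb_iff' hN _ (ext_ne σ hq hne) _).mp hR.2).2.1
  rw [← h1]
  exact (Equiv.sum_comp ((permEquiv H σ).trans
    (piFinCast (fun i => H (extendPerm σ i)) hq)).symm (fun i => R i i)).symm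

theorem K_int (hN : 1 ≤ N) (h : IsInv σ π) (hq : q = 2 * N) (hne : ∀ j < q, Nonempty (H j))
    {X : Matrix (∀ j : Fin q, H j) (∀ j : Fin q, H j) ℂ} (hXh : X.IsHermitian)
    (hX : X ∈ Submodule.span ℂ (ALP q H π)) :
    ∃ ε : ℝ, 0 < ε ∧ (((dE (2 * N) (fun i => H (extendPerm σ i)) / dAll q H : ℝ) : ℂ) •
      (1 : Matrix _ _ ℂ) + (ε : ℂ) • X) ∈ KS H σ hq := by
  set e := (permEquiv H σ).trans (piFinCast (fun i => H (extendPerm σ i)) hq) with he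
  have hX' : Matrix.reindex e e X ∈ Submodule.span ℂ (AL (2 * N) (fun i => H (extendPerm σ i))) := by
    have := Submodule.mem_map_of_mem (f := (Matrix.reindexLinearEquiv ℂ ℂ e e).toLinearMap) hX
    rw [Submodule.map_span] at this
    refine Submodule.span_mono ?_ this
    rintro _ ⟨_, ⟨C, rfl, j0, hj, hC⟩, rfl⟩
    exact ⟨_, TT_perm H σ hq C, _, hj, plast_last h hq hC⟩
  obtain ⟨ε, hε, h1, h2⟩ := cond_interior (ext_ne σ hq hne) (hXh.submatrix e.symm) hX'
  rw [dAll_perm σ hq] at h1 h2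
  refine ⟨ε, hε, ?_⟩
  set Z := ((dE (2 * N) (fun i => H (extendPerm σ i)) / dAll q H : ℝ) : ℂ) •
      (1 : Matrix (∀ j : Fin q, H j) (∀ j : Fin q, H j) ℂ) + (ε : ℂ) • X with hZ
  have hre : Matrix.reindex e e Z = ((dE (2 * N) (fun i => H (extendPerm σ i)) / dAll q H : ℝ) : ℂ) •
      (1 : Matrix _ _ ℂ) + (ε : ℂ) • X.submatrix e.symm e.symm := by
    rw [hZ]
    ext x y
    simp [Matrix.one_apply]
  have hZP : (Matrix.reindex e e Z).PosSemidef := by rw [hre]; exact h1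
  refine ⟨?_, ?_⟩
  · have := hZP.submatrix e
    simpa using this
  · refine (comb_iff' hN _ (ext_ne σ hq hne) _).mpr ⟨hZP, ?_⟩
    rw [hre]; exact h2

end PermK

section MainND
variable {a b : ℕ} {H : ℕ → Type} [∀ j, Fintype (H j)] [∀ j, DecidableEq (H j)]

def BadC (a b : ℕ) (H : ℕ → Type) [∀ j, Fintype (H j)] [∀ j, DecidableEq (H j)]
    (C : ∀ j, Matrix (H j) (H j) ℂ) : Prop :=
  (∀ j < a + b, (C j).IsHermitian) ∧
  (((∃ k, Even k ∧ LastAt b (fun i => H (a + i)) (fun i => C (a + i)) k) ∧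
      ((∀ j < a, C j = 1) ∨ ∃ k, Odd k ∧ LastAt a H C k)) ∨
    ((∀ i < b, C (a + i) = 1) ∧ ∃ k, Odd k ∧ LastAt a H C k))

def PCond (a b : ℕ) (H : ℕ → Type) [∀ j, Fintype (H j)] [∀ j, DecidableEq (H j)]
    (R : Matrix (∀ j : Fin (a + b), H j) (∀ j : Fin (a + b), H j) ℂ) : Prop :=
  trace R * (dE a H : ℂ) = (dE b (fun i => H (a + i)) : ℂ) * (dAll a H : ℂ) ∧
    ∀ C, BadC a b H C → trace (R * TT (a + b) H C) = 0

theorem join_trace (R : Matrix (∀ j : Fin (a + b), H j) (∀ j : Fin (a + b), H j) ℂ)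
    (C : ∀ j, Matrix (H j) (H j) ℂ) :
    trace (R * TT (a + b) H C) = trace (Matrix.reindex (splitPi a b H) (splitPi a b H) R *
      (TT a H C ⊗ₖ TT b (fun i => H (a + i)) (fun i => C (a + i)))) := by
  rw [← trace_reindex_mul (splitPi a b H), TT_split]

theorem TT_one' (A : ∀ j, Matrix (H j) (H j) ℂ) (h : ∀ j < a, A j = 1) : TT a H A = 1 :=
  (TT_congr h).trans TT_one

theorem D_to_P {m n : ℕ} (hm : 1 ≤ m) (hn : 1 ≤ n)
    (hne : ∀ j < 2 * m + 2 * n, Nonempty (H j))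
    (R : Matrix (∀ j : Fin (2 * m + 2 * n), H j) (∀ j : Fin (2 * m + 2 * n), H j) ℂ)
    (hD : ∀ M ∈ Comb m H,
        ptrLeft ((M ⊗ₖ (1 : Matrix (∀ j : Fin (2 * n), H (2 * m + j))
              (∀ j : Fin (2 * n), H (2 * m + j)) ℂ)) *
            (Matrix.reindex (splitPi (2 * m) (2 * n) H) (splitPi (2 * m) (2 * n) H) R)) ∈
          Comb n (fun i => H (2 * m + i))) : PCond (2 * m) (2 * n) H R := by
  have hneA : ∀ j < 2 * m, Nonempty (H j) := fun j hj => hne _ (by omega)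
  have hneB : ∀ j < 2 * n, Nonempty (H (2 * m + j)) := fun j hj => hne _ (by omega)
  set R' := Matrix.reindex (splitPi (2 * m) (2 * n) H) (splitPi (2 * m) (2 * n) H) R with hR'
  have hE := dE_pos hneA
  have hA := dAll_pos hneA
  have hEc : (dE (2 * m) H : ℂ) ≠ 0 := by exact_mod_cast hE.ne'
  have hAc : (dAll (2 * m) H : ℂ) ≠ 0 := by exact_mod_cast hA.ne'
  have lin : ∀ (x y : ℂ) (S T : Matrix (∀ j : Fin (2 * m), H j) (∀ j : Fin (2 * m), H j) ℂ)
      (N : Matrix (∀ j : Fin (2 * n), H (2 * m + j)) (∀ j : Fin (2 * n), H (2 * m + j)) ℂ),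
      trace (R' * ((x • S + y • T) ⊗ₖ N)) = x * trace (R' * (S ⊗ₖ N)) + y * trace (R' * (T ⊗ₖ N)) := by
    intro x y S T N
    simp only [Matrix.add_kronecker, Matrix.smul_kronecker, mul_add, mul_smul_comm,
      Matrix.trace_add, Matrix.trace_smul, smul_eq_mul]
  have key : ∀ M ∈ Comb m H, trace (R' * (M ⊗ₖ 1)) = (dE (2 * n) (fun i => H (2 * m + i)) : ℂ) ∧
      ∀ N k, Even k → LastAt (2 * n) (fun i => H (2 * m + i)) N k →
        trace (R' * (M ⊗ₖ TT (2 * n) (fun i => H (2 * m + i)) N)) = 0 := by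
    intro M hM
    have h1 := ((comb_iff' hn _ hneB _).mp (hD M hM)).2
    refine ⟨?_, fun N k hk hN => ?_⟩
    · rw [← ptrLeft_trace, mul_one]; exact h1.1
    · rw [← ptrLeft_trace]; exact h1.2 N k hk hN
  have int : ∀ X : Matrix (∀ j : Fin (2 * m), H j) (∀ j : Fin (2 * m), H j) ℂ, X.IsHermitian →
      X ∈ Submodule.span ℂ (AL (2 * m) H) → ∃ ε : ℝ, 0 < ε ∧
        (((dE (2 * m) H / dAll (2 * m) H : ℝ) : ℂ) • (1 : Matrix _ _ ℂ) + (ε : ℂ) • X) ∈ Comb m H := by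
    intro X h1 h2
    obtain ⟨ε, hε, h3, h4⟩ := cond_interior hneA h1 h2
    exact ⟨ε, hε, (comb_iff' hm _ hneA _).mpr ⟨h3, h4⟩⟩
  obtain ⟨c, hc, hcd⟩ : ∃ c : ℂ, c ≠ 0 ∧ ((dE (2 * m) H / dAll (2 * m) H : ℝ) : ℂ) = c :=
    ⟨_, by push_cast; exact div_ne_zero hEc hAc, rfl⟩
  have hM0 : c • (1 : Matrix (∀ j : Fin (2 * m), H j) (∀ j : Fin (2 * m), H j) ℂ) ∈ Comb m H := by
    obtain ⟨ε, -, h⟩ := int 0 Matrix.isHermitian_zero (Submodule.zero_mem _)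
    rw [smul_zero, add_zero, hcd] at h
    exact h
  have sm : ∀ (N : Matrix (∀ j : Fin (2 * n), H (2 * m + j)) (∀ j : Fin (2 * n), H (2 * m + j)) ℂ)
      (z : ℂ), (∀ M ∈ Comb m H, trace (R' * (M ⊗ₖ N)) = z) →
      c * trace (R' * (1 ⊗ₖ N)) = z ∧ ∀ A k, Odd k → LastAt (2 * m) H A k →
        trace (R' * (TT (2 * m) H A ⊗ₖ N)) = 0 := by
    intro N z h
    have h0 : c * trace (R' * (1 ⊗ₖ N)) = z := by
      have := h _ hM0
      rwa [Matrix.smul_kronecker, mul_smul_comm, Matrix.trace_smul, smul_eq_mul] at this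
    refine ⟨h0, fun A k hk hA => ?_⟩
    obtain ⟨ε, hε, h1⟩ := int _ (TT_herm hA.2.1) (Submodule.subset_span ⟨A, rfl, k, hk, hA⟩)
    have := h _ h1
    rw [lin, hcd, h0] at this
    have hεc : (ε : ℂ) ≠ 0 := by exact_mod_cast hε.ne'
    exact (mul_eq_zero.mp (add_eq_left.mp this)).resolve_left hεc
  have s1 := sm 1 _ (fun M hM => (key M hM).1)
  refine ⟨?_, ?_⟩
  · have h1 : trace R = trace (R' * (1 ⊗ₖ 1)) := by
      have := join_trace R (fun _ => 1)
      rw [TT_one, mul_one, TT_one] at this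
      rw [this]
      congr 3
      exact TT_one (q := 2 * n) (H := fun i => H (2 * m + i))
    rw [h1, ← s1.1, ← hcd]
    push_cast
    field_simp
  · rintro C ⟨-, ⟨⟨k, hk, hB⟩, hA⟩ | ⟨hB, l, hl, hA⟩⟩
    · have s2 := sm _ 0 (fun M hM => (key M hM).2 _ k hk hB)
      rw [join_trace]
      rcases hA with hA | ⟨l, hl, hA⟩
      · rw [TT_one' C hA]
        exact (mul_eq_zero.mp s2.1).resolve_left hc
      · exact s2.2 C l hl hA
    · rw [join_trace, TT_one' (H := fun i => H (2 * m + i)) (fun i => C (2 * m + i)) hB]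
      exact s1.2 C l hl hA

theorem P_to_D {m n : ℕ} (hm : 1 ≤ m) (hn : 1 ≤ n)
    (hne : ∀ j < 2 * m + 2 * n, Nonempty (H j))
    (R : Matrix (∀ j : Fin (2 * m + 2 * n), H j) (∀ j : Fin (2 * m + 2 * n), H j) ℂ)
    (hR : R.PosSemidef) (hP : PCond (2 * m) (2 * n) H R) : ∀ M ∈ Comb m H,
        ptrLeft ((M ⊗ₖ (1 : Matrix (∀ j : Fin (2 * n), H (2 * m + j))
              (∀ j : Fin (2 * n), H (2 * m + j)) ℂ)) *
            (Matrix.reindex (splitPi (2 * m) (2 * n) H) (splitPi (2 * m) (2 * n) H) R)) ∈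
          Comb n (fun i => H (2 * m + i)) := by
  have hneA : ∀ j < 2 * m, Nonempty (H j) := fun j hj => hne _ (by omega)
  have hneB : ∀ j < 2 * n, Nonempty (H (2 * m + j)) := fun j hj => hne _ (by omega)
  have hR' := reindex_psd (splitPi (2 * m) (2 * n) H) hR
  have jt := join_trace R
  set R' := Matrix.reindex (splitPi (2 * m) (2 * n) H) (splitPi (2 * m) (2 * n) H) R with hR'd
  have hE := dE_pos hneA
  have hA := dAll_pos hneA
  have hEc : (dE (2 * m) H : ℂ) ≠ 0 := by exact_mod_cast hE.ne'
  have hAc : (dAll (2 * m) H : ℂ) ≠ 0 := by exact_mod_cast hA.ne'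
  have TTB1 : TT (2 * n) (fun i => H (2 * m + i)) (fun _ => 1) = 1 :=
    TT_one (q := 2 * n) (H := fun i => H (2 * m + i))
  -- evaluation on joined families
  have ev : ∀ (A : ∀ j, Matrix (H j) (H j) ℂ) (N : ∀ i, Matrix (H (2 * m + i)) (H (2 * m + i)) ℂ),
      (∀ j < 2 * m, (A j).IsHermitian) → (∀ i < 2 * n, (N i).IsHermitian) →
      (((∃ k, Even k ∧ LastAt (2 * n) (fun i => H (2 * m + i)) N k) ∧
      ((∀ j < 2 * m, A j = 1) ∨ ∃ k, Odd k ∧ LastAt (2 * m) H A k)) ∨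
        ((∀ i < 2 * n, N i = 1) ∧ ∃ k, Odd k ∧ LastAt (2 * m) H A k)) →
      trace (R' * (TT (2 * m) H A ⊗ₖ TT (2 * n) (fun i => H (2 * m + i)) N)) = 0 := by
    intro A N hAh hNh hbad
    obtain ⟨C, hC1, hC2⟩ := join_fam (2 * m) H A N
    have hN : (fun i => C (2 * m + i)) = N := funext hC2
    have hCA : TT (2 * m) H C = TT (2 * m) H A := TT_congr hC1
    have := jt C
    rw [hCA, hN] at this
    rw [← this]
    have hl : ∀ k, LastAt (2 * m) H A k → LastAt (2 * m) H C k := by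
      intro k hk
      refine ⟨hk.1, fun j hj => by rw [hC1 j hj]; exact hAh j hj, ?_, fun j h1 h2 => ?_⟩
      · rw [hC1 k hk.1]; exact hk.2.2.1
      · rw [hC1 j h2]; exact hk.2.2.2 j h1 h2
    refine hP.2 C ⟨fun j hj => ?_, ?_⟩
    · rcases Nat.lt_or_ge j (2 * m) with h | h
      · rw [hC1 j h]; exact hAh j h
      · obtain ⟨i, rfl⟩ := Nat.exists_eq_add_of_le h
        rw [hC2 i]; exact hNh i (by omega)
    · rw [hN]
      rcases hbad with ⟨h1, h2 | ⟨k, hk, h2⟩⟩ | ⟨h1, k, hk, h2⟩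
      · exact Or.inl ⟨h1, Or.inl fun j hj => by rw [hC1 j hj, h2 j hj]⟩
      · exact Or.inl ⟨h1, Or.inr ⟨k, hk, hl k h2⟩⟩
      · exact Or.inr ⟨fun i hi => by rw [hC2 i, h1 i hi], k, hk, hl k h2⟩
  have h11 : trace R = trace (R' * (1 ⊗ₖ 1)) := by
    have := jt (fun _ => 1)
    rw [TT_one, mul_one, TT_one] at this
    rw [this]
    congr 3
  intro M hM
  have hMc := (comb_iff' hm _ hneA _).mp hM
  have hMs := kill_span hMc.2.2
  refine (comb_iff' hn _ hneB _).mpr ⟨ptrLeft_link_psd hMc.1 hR', ?_, ?_⟩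
  · have lin : ∀ X, X ∈ Submodule.span ℂ ({1} ∪ AL (2 * m) H) →
        trace (R' * (X ⊗ₖ (1 : Matrix (∀ j : Fin (2 * n), H (2 * m + j))
              (∀ j : Fin (2 * n), H (2 * m + j)) ℂ))) = trace R / dAll (2 * m) H * trace X := by
      intro X hX
      clear hM hMc hMs
      induction hX using Submodule.span_induction with
      | mem X hX =>
        rcases hX with hX | ⟨A, rfl, k, hk, hB⟩
        · rw [Set.mem_singleton_iff] at hX
          subst hX
          rw [← h11, trace_one_dAll]
          field_simp
        · rw [TT_trace_zero hB.1 hB.2.2.1, mul_zero, ← TTB1]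
          exact ev A _ hB.2.1 (fun i _ => Matrix.isHermitian_one)
            (Or.inr ⟨fun i _ => rfl, k, hk, hB⟩)
      | zero => simp
      | add X Y _ _ h1 h2 => rw [Matrix.add_kronecker, mul_add, Matrix.trace_add, h1, h2, Matrix.trace_add]; ring
      | smul z X _ h1 =>
        rw [Matrix.smul_kronecker, mul_smul_comm, Matrix.trace_smul, h1, Matrix.trace_smul,
          smul_eq_mul, smul_eq_mul]; ring
    have h2 := lin M hMs
    rw [← ptrLeft_trace, mul_one, hMc.2.1] at h2
    refine h2.trans ?_
    have := hP.1
    field_simp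
    linear_combination this
  · intro N k hk hN
    have lin : ∀ X, X ∈ Submodule.span ℂ ({1} ∪ AL (2 * m) H) →
        trace (R' * (X ⊗ₖ TT (2 * n) (fun i => H (2 * m + i)) N)) = 0 := by
      intro X hX
      clear hM hMc hMs
      induction hX using Submodule.span_induction with
      | mem X hX =>
        rcases hX with hX | ⟨A, rfl, l, hl, hB⟩
        · rw [Set.mem_singleton_iff] at hX
          subst hX
          rw [← TT_one]
          exact ev _ _ (fun i _ => Matrix.isHermitian_one) hN.2.1
            (Or.inl ⟨⟨k, hk, hN⟩, Or.inl fun _ _ => rfl⟩)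
        · exact ev A _ hB.2.1 hN.2.1 (Or.inl ⟨⟨k, hk, hN⟩, Or.inr ⟨l, hl, hB⟩⟩)
      | zero => simp
      | add X Y _ _ h1 h2 => rw [Matrix.add_kronecker, mul_add, Matrix.trace_add, h1, h2, add_zero]
      | smul z X _ h1 =>
        rw [Matrix.smul_kronecker, mul_smul_comm, Matrix.trace_smul, h1, smul_zero]
    have h2 := lin M hMs
    rw [← ptrLeft_trace] at h2
    exact h2

end MainND

section MainND2
variable {m n : ℕ} {H : ℕ → Type} [∀ j, Fintype (H j)] [∀ j, DecidableEq (H j)]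

def piA (m : ℕ) : ℕ → ℕ := fun j => if j = 2 * m then 0 else if j < 2 * m then j + 1 else j

def piB (m n : ℕ) : ℕ → ℕ := fun j => if j < 2 * m then j + (2 * n - 1)
      else if j < 2 * m + 2 * n - 1 then j - 2 * m else j

theorem inv_KA (hm : 1 ≤ m) (hn : 1 ≤ n) : IsInv (cycleKA m n hm hn) (piA m) := fun _ _ => rfl

theorem inv_KB (hm : 1 ≤ m) (hn : 1 ≤ n) : IsInv (cycleKB m n hm hn) (piB m n) := fun _ _ => rfl

theorem piA_A {j : ℕ} (h : j < 2 * m) : piA m j = j + 1 := by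
  unfold piA; rw [if_neg (by omega), if_pos h]

theorem piA_B {i : ℕ} (h : 1 ≤ i) : piA m (2 * m + i) = 2 * m + i := by
  unfold piA; rw [if_neg (by omega), if_neg (by omega)]

theorem piA_0 : piA m (2 * m) = 0 := by
  unfold piA; rw [if_pos rfl]

theorem piB_A {j : ℕ} (h : j < 2 * m) : piB m n j = j + (2 * n - 1) := by
  unfold piB; rw [if_pos h]

theorem piB_B {i : ℕ} (h : i < 2 * n - 1) : piB m n (2 * m + i) = i := by
  unfold piB; rw [if_neg (by omega), if_pos (by omega)]; omega

theorem piB_L (hn : 1 ≤ n) : piB m n (2 * m + (2 * n - 1)) = 2 * m + (2 * n - 1) := by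
  unfold piB; rw [if_neg (by omega), if_neg (by omega)]

theorem parA (hn : 1 ≤ n) : (∀ j < 2 * m, Even (piA m j) ↔ ¬ Even j) ∧
    ∀ j < 2 * n, Even (piA m (2 * m + j)) ↔ Even j := by
  refine ⟨fun j hj => ?_, fun j hj => ?_⟩
  · rw [piA_A hj, Nat.even_add_one]
  · rcases Nat.eq_zero_or_pos j with rfl | h
    · rw [add_zero, piA_0]
    · rw [piA_B h]; simp [Nat.even_add]

theorem parB (hn : 1 ≤ n) : (∀ j < 2 * m, Even (piB m n j) ↔ ¬ Even j) ∧
    ∀ j < 2 * n, Even (piB m n (2 * m + j)) ↔ Even j := by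
  refine ⟨fun j hj => ?_, fun j hj => ?_⟩
  · rw [piB_A hj]; simp only [Nat.even_iff]; omega
  · rcases Nat.lt_or_ge j (2 * n - 1) with h | h
    · rw [piB_B h]
    · have : j = 2 * n - 1 := by omega
      subst this
      rw [piB_L hn]; simp [Nat.even_add]

/-- plast criterion for the first ordering at a `B` position `≥ 1`. -/
theorem plA_B {C : ∀ j, Matrix (H j) (H j) ℂ} {k : ℕ} (hk0 : 1 ≤ k)
    (hh : ∀ j < 2 * m + 2 * n, (C j).IsHermitian)
    (hk : k < 2 * n) (ht : trace (C (2 * m + k)) = 0) (hl : ∀ i, k < i → i < 2 * n → C (2 * m + i) = 1) :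
    PLast (2 * m + 2 * n) H (piA m) C (2 * m + k) := by
  refine ⟨by omega, hh, ht, fun j hj h => ?_⟩
  rw [piA_B hk0] at h
  have : 2 * m + k < j := by
    unfold piA at h
    split_ifs at h <;> omega
  obtain ⟨i, rfl⟩ := Nat.exists_eq_add_of_le (by omega : 2 * m ≤ j)
  exact hl i (by omega) (by omega)

theorem plA_A {C : ∀ j, Matrix (H j) (H j) ℂ} {k : ℕ}
    (hh : ∀ j < 2 * m + 2 * n, (C j).IsHermitian)
    (hk : k < 2 * m) (ht : trace (C k) = 0) (hl : ∀ j, k < j → j < 2 * m → C j = 1)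
    (hB : ∀ i, 1 ≤ i → i < 2 * n → C (2 * m + i) = 1) :
    PLast (2 * m + 2 * n) H (piA m) C k := by
  refine ⟨by omega, hh, ht, fun j hj h => ?_⟩
  rw [piA_A hk] at h
  rcases Nat.lt_or_ge j (2 * m) with h1 | h1
  · rw [piA_A h1] at h; exact hl j (by omega) h1
  · obtain ⟨i, rfl⟩ := Nat.exists_eq_add_of_le h1
    refine hB i ?_ (by omega)
    by_contra h2
    have : i = 0 := by omega
    subst this
    rw [add_zero, piA_0] at h; omega

theorem plB_A {C : ∀ j, Matrix (H j) (H j) ℂ} {k : ℕ}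
    (hh : ∀ j < 2 * m + 2 * n, (C j).IsHermitian)
    (hk : k < 2 * m) (ht : trace (C k) = 0) (hl : ∀ j, k < j → j < 2 * m → C j = 1)
    (hB : C (2 * m + (2 * n - 1)) = 1) :
    PLast (2 * m + 2 * n) H (piB m n) C k := by
  refine ⟨by omega, hh, ht, fun j hj h => ?_⟩
  rw [piB_A hk] at h
  rcases Nat.lt_or_ge j (2 * m) with h1 | h1
  · rw [piB_A h1] at h; exact hl j (by omega) h1
  · obtain ⟨i, rfl⟩ := Nat.exists_eq_add_of_le h1
    by_cases h2 : i < 2 * n - 1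
    · rw [piB_B h2] at h; omega
    · have : i = 2 * n - 1 := by omega
      subst this; exact hB

theorem plB_B {C : ∀ j, Matrix (H j) (H j) ℂ} {k : ℕ}
    (hh : ∀ j < 2 * m + 2 * n, (C j).IsHermitian)
    (hk : k < 2 * n - 1) (ht : trace (C (2 * m + k)) = 0) (hA : ∀ j, j < 2 * m → C j = 1)
    (hl : ∀ i, k < i → i < 2 * n → C (2 * m + i) = 1) :
    PLast (2 * m + 2 * n) H (piB m n) C (2 * m + k) := by
  refine ⟨by omega, hh, ht, fun j hj h => ?_⟩
  rw [piB_B hk] at h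
  rcases Nat.lt_or_ge j (2 * m) with h1 | h1
  · exact hA j h1
  · obtain ⟨i, rfl⟩ := Nat.exists_eq_add_of_le h1
    refine hl i ?_ (by omega)
    by_cases h2 : i < 2 * n - 1
    · rwa [piB_B h2] at h
    · omega

theorem KA_bad {C : ∀ j, Matrix (H j) (H j) ℂ} (hn : 1 ≤ n) (hC : BadC (2 * m) (2 * n) H C) :
    ∃ j0, Even (piA m j0) ∧ PLast (2 * m + 2 * n) H (piA m) C j0 := by
  obtain ⟨hh, ⟨⟨k, hk, hB⟩, hA⟩ | ⟨hB, l, hl, hA⟩⟩ := hC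
  · rcases Nat.eq_zero_or_pos k with rfl | hk0
    · rcases hA with hA | ⟨l, hl, hA⟩
      · refine ⟨2 * m, by rw [piA_0]; simp, by omega, hh, hB.2.2.1, fun j hj h => ?_⟩
        rw [piA_0] at h
        rcases Nat.lt_or_ge j (2 * m) with h1 | h1
        · exact hA j h1
        · obtain ⟨i, rfl⟩ := Nat.exists_eq_add_of_le h1
          refine hB.2.2.2 i ?_ (by omega)
          by_contra h2
          have : i = 0 := by omega
          subst this
          rw [add_zero, piA_0] at h; omega
      · refine ⟨l, by rw [piA_A hA.1]; exact hl.add_one, plA_A hh hA.1 hA.2.2.1 hA.2.2.2 ?_⟩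
        exact fun i h1 h2 => hB.2.2.2 i (by omega) h2
    · exact ⟨2 * m + k, ((parA hn).2 k hB.1).mpr hk, plA_B hk0 hh hB.1 hB.2.2.1 hB.2.2.2⟩
  · exact ⟨l, by rw [piA_A hA.1]; exact hl.add_one, plA_A hh hA.1 hA.2.2.1 hA.2.2.2
      fun i h1 h2 => hB i h2⟩

theorem KB_bad {C : ∀ j, Matrix (H j) (H j) ℂ} (hn : 1 ≤ n) (hC : BadC (2 * m) (2 * n) H C) :
    ∃ j0, Even (piB m n j0) ∧ PLast (2 * m + 2 * n) H (piB m n) C j0 := by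
  obtain ⟨hh, ⟨⟨k, hk, hB⟩, hA⟩ | ⟨hB, l, hl, hA⟩⟩ := hC
  · have hkn : k < 2 * n - 1 := by
      have := hB.1
      rw [Nat.even_iff] at hk; omega
    rcases hA with hA | ⟨l, hl, hA⟩
    · exact ⟨2 * m + k, ((parB hn).2 k hB.1).mpr hk, plB_B hh hkn hB.2.2.1 hA hB.2.2.2⟩
    · exact ⟨l, ((parB hn).1 l hA.1).mpr (Nat.not_even_iff_odd.mpr hl),
        plB_A hh hA.1 hA.2.2.1 hA.2.2.2 (hB.2.2.2 _ hkn (by omega))⟩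
  · exact ⟨l, ((parB hn).1 l hA.1).mpr (Nat.not_even_iff_odd.mpr hl),
        plB_A hh hA.1 hA.2.2.1 hA.2.2.2 (hB _ (by omega))⟩

theorem P_span (hn : 1 ≤ n)
    {R : Matrix (∀ j : Fin (2 * m + 2 * n), H j) (∀ j : Fin (2 * m + 2 * n), H j) ℂ}
    (hP : PCond (2 * m) (2 * n) H R) :
    R ∈ Submodule.span ℂ ({1} ∪ (ALP (2 * m + 2 * n) H (piA m) ∪ ALP (2 * m + 2 * n) H (piB m n))) := by
  refine Submodule.span_mono ?_ (decomp R)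
  rintro _ ⟨s, A, hA, rfl, A', hA', hne⟩
  have hnb : ¬ BadC (2 * m) (2 * n) H A' := fun h => hne (hP.2 A' h)
  have hh : ∀ j < 2 * m + 2 * n, (A j).IsHermitian := fun j hj => (hA.2 j hj).1
  have hh' : ∀ j < 2 * m + 2 * n, (A' j).IsHermitian := fun j hj => (hA'.2 j hj).1
  rcases class_string (fun i => 2 * m + i ∈ s) (2 * n) with hb | ⟨k, hk, hks, hkl⟩
  · rcases class_string (fun i => i ∈ s) (2 * m) with ha | ⟨l, hl, hls, hll⟩
    · left
      rw [Set.mem_singleton_iff]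
      refine TT_one' A fun j hj => (hA.2 j hj).2.2 ?_
      rcases Nat.lt_or_ge j (2 * m) with h1 | h1
      · exact ha j h1
      · obtain ⟨i, rfl⟩ := Nat.exists_eq_add_of_le h1
        exact hb i (by omega)
    · rcases Nat.even_or_odd l with he | ho
      · right; left
        refine ⟨A, rfl, l, by rw [piA_A hl]; exact he.add_one, plA_A hh hl
          ((hA.2 l (by omega)).2.1 hls) (fun j h1 h2 => (hA.2 j (by omega)).2.2 (hll j h1 h2)) ?_⟩
        exact fun i _ h2 => (hA.2 _ (by omega)).2.2 (hb i h2)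
      · refine absurd ⟨hh', Or.inr ⟨fun i hi => (hA'.2 _ (by omega)).2.2 (hb i hi), l, ho, hl,
          fun j hj => hh' j (by omega), (hA'.2 l (by omega)).2.1 hls,
          fun j h1 h2 => (hA'.2 j (by omega)).2.2 (hll j h1 h2)⟩⟩ hnb
  · rcases Nat.even_or_odd k with he | ho
    · have hB' : LastAt (2 * n) (fun i => H (2 * m + i)) (fun i => A' (2 * m + i)) k :=
        ⟨hk, fun j hj => hh' _ (by omega), (hA'.2 _ (by omega)).2.1 hks,
          fun j h1 h2 => (hA'.2 _ (by omega)).2.2 (hkl j h1 h2)⟩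
      rcases class_string (fun i => i ∈ s) (2 * m) with ha | ⟨l, hl, hls, hll⟩
      · exact absurd ⟨hh', Or.inl ⟨⟨k, he, hB'⟩,
          Or.inl fun j hj => (hA'.2 j (by omega)).2.2 (ha j hj)⟩⟩ hnb
      · rcases Nat.even_or_odd l with he' | ho'
        · right; right
          refine ⟨A, rfl, l, Nat.not_even_iff_odd.mp ?_, plB_A hh hl
            ((hA.2 l (by omega)).2.1 hls) (fun j h1 h2 => (hA.2 j (by omega)).2.2 (hll j h1 h2)) ?_⟩
          · rw [(parB hn).1 l hl]; exact fun h => h he'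
          · refine (hA.2 _ (by omega)).2.2 (hkl _ ?_ (by omega))
            rw [Nat.even_iff] at he; omega
        · exact absurd ⟨hh', Or.inl ⟨⟨k, he, hB'⟩, Or.inr ⟨l, ho', hl,
            fun j hj => hh' j (by omega), (hA'.2 l (by omega)).2.1 hls,
            fun j h1 h2 => (hA'.2 j (by omega)).2.2 (hll j h1 h2)⟩⟩⟩ hnb
    · right; left
      refine ⟨A, rfl, 2 * m + k, Nat.not_even_iff_odd.mp ?_, plA_B ho.pos hh hk
        ((hA.2 _ (by omega)).2.1 hks) fun i h1 h2 => (hA.2 _ (by omega)).2.2 (hkl i h1 h2)⟩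
      rw [(parA hn).2 k hk]; exact Nat.not_even_iff_odd.mpr ho

theorem ALP_star {q : ℕ} {π : ℕ → ℕ} {X : Matrix (∀ j : Fin q, H j) (∀ j : Fin q, H j) ℂ}
    (hX : X ∈ Submodule.span ℂ (ALP q H π)) : Xᴴ ∈ Submodule.span ℂ (ALP q H π) := by
  induction hX using Submodule.span_induction with
  | mem X hX =>
    obtain ⟨C, rfl, j0, h1, h2⟩ := hX
    rw [(TT_herm h2.2.1).eq]
    exact Submodule.subset_span ⟨C, rfl, j0, h1, h2⟩
  | zero => simp
  | add X Y _ _ h1 h2 => rw [Matrix.conjTranspose_add]; exact Submodule.add_mem _ h1 h2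
  | smul z X _ h1 => rw [Matrix.conjTranspose_smul]; exact Submodule.smul_mem _ _ h1

theorem ALP_trace {q : ℕ} {π : ℕ → ℕ} {X : Matrix (∀ j : Fin q, H j) (∀ j : Fin q, H j) ℂ}
    (hX : X ∈ Submodule.span ℂ (ALP q H π)) : trace X = 0 := by
  have := trace_pair_zero_of_span (R := 1) hX ?_
  · simpa using this
  · rintro _ ⟨B, rfl, l, hl, hB⟩
    rw [one_mul]; exact TT_trace_zero hB.1 hB.2.2.1

theorem K_to_P (hm : 1 ≤ m) (hn : 1 ≤ n) (hne : ∀ j < 2 * m + 2 * n, Nonempty (H j))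
    (hq : 2 * m + 2 * n = 2 * (m + n))
    {R : Matrix (∀ j : Fin (2 * m + 2 * n), H j) (∀ j : Fin (2 * m + 2 * n), H j) ℂ}
    (hR : R ∈ KS H (cycleKA m n hm hn) hq ∪ KS H (cycleKB m n hm hn) hq) :
    PCond (2 * m) (2 * n) H R := by
  rcases hR with hR | hR
  · refine ⟨?_, fun C hC => ?_⟩
    · rw [K_trace (by omega) hq hne hR]
      exact_mod_cast dE_perm' (inv_KA hm hn) hq (parA hn).1 (parA hn).2
    · obtain ⟨j0, h1, h2⟩ := KA_bad hn hC
      exact K_kill (by omega) (inv_KA hm hn) hq hne hR h2 h1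
  · refine ⟨?_, fun C hC => ?_⟩
    · rw [K_trace (by omega) hq hne hR]
      exact_mod_cast dE_perm' (inv_KB hm hn) hq (parB hn).1 (parB hn).2
    · obtain ⟨j0, h1, h2⟩ := KB_bad hn hC
      exact K_kill (by omega) (inv_KB hm hn) hq hne hR h2 h1

theorem aff_to_P (hm : 1 ≤ m) (hn : 1 ≤ n) (hne : ∀ j < 2 * m + 2 * n, Nonempty (H j))
    (hq : 2 * m + 2 * n = 2 * (m + n))
    {R : Matrix (∀ j : Fin (2 * m + 2 * n), H j) (∀ j : Fin (2 * m + 2 * n), H j) ℂ}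
    (hR : R ∈ affineSpan ℝ (KS H (cycleKA m n hm hn) hq ∪ KS H (cycleKB m n hm hn) hq)) :
    PCond (2 * m) (2 * n) H R := by
  refine affineSpan_induction hR (fun R hR => K_to_P hm hn hne hq hR) ?_
  · intro c u v w hu hv hw
    simp only [vsub_eq_sub, vadd_eq_add]
    refine ⟨?_, fun C hC => ?_⟩
    · rw [Matrix.trace_add, Matrix.trace_smul, Matrix.trace_sub, add_mul, hw.1, Complex.real_smul, mul_assoc,
        sub_mul, hu.1, hv.1]; ring
    · rw [add_mul, smul_mul_assoc, sub_mul, Matrix.trace_add, Matrix.trace_smul, Matrix.trace_sub,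
        hu.2 C hC, hv.2 C hC, hw.2 C hC]; simp

theorem P_to_aff (hm : 1 ≤ m) (hn : 1 ≤ n) (hne : ∀ j < 2 * m + 2 * n, Nonempty (H j))
    (hq : 2 * m + 2 * n = 2 * (m + n))
    {R : Matrix (∀ j : Fin (2 * m + 2 * n), H j) (∀ j : Fin (2 * m + 2 * n), H j) ℂ}
    (hRh : R.IsHermitian) (hR : PCond (2 * m) (2 * n) H R) :
    R ∈ affineSpan ℝ (KS H (cycleKA m n hm hn) hq ∪ KS H (cycleKB m n hm hn) hq) := by
  have hsp := P_span hn hR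
  rw [Submodule.span_union, Submodule.mem_sup] at hsp
  obtain ⟨Z, hZ, W, hW, hsum⟩ := hsp
  rw [Submodule.span_union, Submodule.mem_sup] at hW
  obtain ⟨X, hX, Y, hY, rfl⟩ := hW
  obtain ⟨z, rfl⟩ := Submodule.mem_span_singleton.mp hZ
  have hE := dE_pos (q := 2 * m) (H := H) (fun j hj => hne j (by omega))
  have hA := dAll_pos hne
  have hEc : (dE (2 * m) H : ℂ) ≠ 0 := by exact_mod_cast hE.ne'
  have hAc : (dAll (2 * m + 2 * n) H : ℂ) ≠ 0 := by exact_mod_cast hA.ne'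
  have dA := dE_perm' (H := H) (inv_KA hm hn) hq (parA hn).1 (parA hn).2
  have dB := dE_perm' (H := H) (inv_KB hm hn) hq (parB hn).1 (parB hn).2
  have dAB : dE (2 * (m + n)) (fun i => H (extendPerm (cycleKB m n hm hn) i)) =
      dE (2 * (m + n)) (fun i => H (extendPerm (cycleKA m n hm hn) i)) :=
    mul_right_cancel₀ hE.ne' (dB.trans dA.symm)
  have tR : trace R = (dE (2 * (m + n)) (fun i => H (extendPerm (cycleKA m n hm hn) i)) : ℂ) := by
    refine mul_right_cancel₀ hEc ?_
    rw [hR.1]; exact_mod_cast dA.symm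
  have tz : trace R = z * dAll (2 * m + 2 * n) H := by
    rw [← hsum, Matrix.trace_add, Matrix.trace_add, ALP_trace hX, ALP_trace hY, Matrix.trace_smul,
      trace_one_dAll, smul_eq_mul]; ring
  set c : ℝ := dE (2 * (m + n)) (fun i => H (extendPerm (cycleKA m n hm hn) i)) /
    dAll (2 * m + 2 * n) H with hc
  have hz : z = (c : ℂ) := by
    rw [hc]; push_cast
    rw [eq_div_iff hAc, ← tz, tR]
  set X' := (2⁻¹ : ℂ) • (X + Xᴴ) with hX'
  set Y' := (2⁻¹ : ℂ) • (Y + Yᴴ) with hY'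
  have hherm : ∀ V : Matrix (∀ j : Fin (2 * m + 2 * n), H j) (∀ j : Fin (2 * m + 2 * n), H j) ℂ,
      ((2⁻¹ : ℂ) • (V + Vᴴ)).IsHermitian := by
    intro V
    rw [Matrix.IsHermitian, Matrix.conjTranspose_smul, Matrix.conjTranspose_add,
      Matrix.conjTranspose_conjTranspose, add_comm Vᴴ V]
    simp
  have hRe : R = (c : ℂ) • (1 : Matrix _ _ ℂ) + X' + Y' := by
    have h1 : Rᴴ = (c : ℂ) • (1 : Matrix _ _ ℂ) + (Xᴴ + Yᴴ) := by
      rw [← hsum, hz]; simp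
    have h2 : R = (2⁻¹ : ℂ) • (R + Rᴴ) := by
      rw [hRh.eq, ← two_smul ℂ R, smul_smul]; norm_num
    rw [h2, h1]
    nth_rewrite 1 [← hsum]
    rw [hz, hX', hY']
    module
  have hXs : X' ∈ Submodule.span ℂ (ALP (2 * m + 2 * n) H (piA m)) :=
    Submodule.smul_mem _ _ (Submodule.add_mem _ hX (ALP_star hX))
  have hYs : Y' ∈ Submodule.span ℂ (ALP (2 * m + 2 * n) H (piB m n)) :=
    Submodule.smul_mem _ _ (Submodule.add_mem _ hY (ALP_star hY))
  obtain ⟨ε, hε, h1⟩ := K_int (by omega) (inv_KA hm hn) hq hne (hherm X) hXs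
  obtain ⟨δ, hδ, h2⟩ := K_int (by omega) (inv_KB hm hn) hq hne (hherm Y) hYs
  obtain ⟨_, _, h0⟩ := K_int (by omega) (inv_KA hm hn) hq hne (X := 0) Matrix.isHermitian_zero
    (Submodule.zero_mem _)
  rw [smul_zero, add_zero] at h0
  rw [dAB] at h2
  rw [← hc] at h0 h1 h2
  rw [← hX'] at h1
  rw [← hY'] at h2
  have m0 := subset_affineSpan ℝ (KS H (cycleKA m n hm hn) hq ∪ KS H (cycleKB m n hm hn) hq) (Or.inl h0)
  have m1 := subset_affineSpan ℝ (KS H (cycleKA m n hm hn) hq ∪ KS H (cycleKB m n hm hn) hq) (Or.inl h1)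
  have m2 := subset_affineSpan ℝ (KS H (cycleKA m n hm hn) hq ∪ KS H (cycleKB m n hm hn) hq) (Or.inr h2)
  have m3 := AffineSubspace.smul_vsub_vadd_mem _ ε⁻¹ m1 m0 m0
  have m4 := AffineSubspace.smul_vsub_vadd_mem _ δ⁻¹ m2 m0 m3
  convert m4 using 1
  rw [hRe]
  simp only [vsub_eq_sub, vadd_eq_add, add_sub_cancel_left]
  have e1 : ∀ (t : ℝ) (V : Matrix (∀ j : Fin (2 * m + 2 * n), H j) (∀ j : Fin (2 * m + 2 * n), H j) ℂ),
      0 < t → t⁻¹ • ((t : ℂ) • V) = V := by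
    intro t V ht
    ext x y
    have : (t : ℂ) ≠ 0 := by exact_mod_cast ht.ne'
    simp [this]
  rw [e1 _ _ hε, e1 _ _ hδ]
  abel

end MainND2

section Degenerate

def FE (q : ℕ) (H : ℕ → Type) (k : ℕ) : Prop :=
  k < q ∧ IsEmpty (H k) ∧ ∀ j < k, Nonempty (H j)

def FO (N : ℕ) (H : ℕ → Type) : Prop := ∃ k, FE (2 * N) H k ∧ Odd k

theorem first_empty (q : ℕ) (H : ℕ → Type) : (∀ j < q, Nonempty (H j)) ∨ ∃ k, FE q H k := by
  classical
  by_cases h : ∃ k, k < q ∧ IsEmpty (H k)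
  · right
    refine ⟨Nat.find h, (Nat.find_spec h).1, (Nat.find_spec h).2, fun j hj => ?_⟩
    have := Nat.find_min h hj
    by_contra h1
    exact this ⟨hj.trans (Nat.find_spec h).1, not_nonempty_iff.mp h1⟩
  · left
    intro j hj
    by_contra h1
    exact h ⟨j, hj, not_nonempty_iff.mp h1⟩

theorem FE_uniq {q q' : ℕ} {H : ℕ → Type} {k l : ℕ} (hk : FE q H k) (hl : FE q' H l) : k = l := by
  rcases lt_trichotomy k l with h | h | h
  · exact absurd (hl.2.2 k h) (not_nonempty_iff.mpr hk.2.1)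
  · exact h
  · exact absurd (hk.2.2 l h) (not_nonempty_iff.mpr hl.2.1)

theorem FO_iff {N : ℕ} {H : ℕ → Type} {k : ℕ} (hk : FE (2 * N) H k) : FO N H ↔ Odd k := by
  constructor
  · rintro ⟨l, h1, h2⟩
    rwa [FE_uniq hk h1]
  · intro h; exact ⟨k, hk, h⟩

theorem not_FO_of_all {N : ℕ} {H : ℕ → Type} (h : ∀ j < 2 * N, Nonempty (H j)) : ¬ FO N H := by
  rintro ⟨k, h1, -⟩
  exact absurd (h k h1.1) (not_nonempty_iff.mpr h1.2.1)

theorem pi_empty {q : ℕ} {H : ℕ → Type} {k : ℕ} (hk : k < q) (he : IsEmpty (H k)) :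
    IsEmpty (∀ j : Fin q, H j) := ⟨fun f => he.false (f ⟨k, hk⟩)⟩

theorem psd_empty {α : Type*} [Fintype α] [IsEmpty α] (R : Matrix α α ℂ) : R.PosSemidef := by
  rw [Subsingleton.elim R 0]; exact Matrix.PosSemidef.zero

theorem comb_ne_of_all {n : ℕ} (hn : 1 ≤ n) (H : ℕ → Type) [∀ j, Fintype (H j)]
    [∀ j, DecidableEq (H j)] (hne : ∀ j < 2 * n, Nonempty (H j)) : (Comb n H).Nonempty := by
  obtain ⟨ε, -, h1, h2⟩ := cond_interior hne (X := 0) Matrix.isHermitian_zero (Submodule.zero_mem _)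
  exact ⟨_, (comb_iff' hn H hne _).mpr ⟨h1, h2⟩⟩

theorem comb_ne_iff (n : ℕ) : ∀ (H : ℕ → Type) [∀ j, Fintype (H j)] [∀ j, DecidableEq (H j)],
    (Comb (n + 1) H).Nonempty ↔ ¬ FO (n + 1) H := by
  induction n with
  | zero =>
    intro H _ _
    rcases first_empty (2 * (0 + 1)) H with h | ⟨k, hk⟩
    · exact iff_of_true (comb_ne_of_all (by omega) H h) (not_FO_of_all h)
    rw [FO_iff hk]
    have hE : IsEmpty (∀ j : Fin (2 * (0 + 1)), H j) := pi_empty hk.1 hk.2.1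
    have hk1 := hk.1
    rcases Nat.eq_zero_or_pos k with rfl | hk0
    · refine iff_of_true ⟨0, Matrix.PosSemidef.zero, ?_⟩ (by simp)
      have : IsEmpty (∀ j : Fin 1, H j) := pi_empty (by omega) hk.2.1
      exact Subsingleton.elim _ _
    · have : k = 1 := by omega
      subst this
      refine iff_of_false ?_ (by simp)
      rintro ⟨R, -, h⟩
      have h1 := hk.2.1
      have h0 := hk.2.2 0 (by omega)
      let x : ∀ j : Fin 1, H j := fun j => cast (congrArg H (by have := j.isLt; omega : 0 = (j : ℕ))) h0.some
      have h2 := congrFun (congrFun h x) x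
      rw [Matrix.one_apply_eq, trLast, Finset.univ_eq_empty, Finset.sum_empty] at h2
      exact zero_ne_one h2
  | succ n ih =>
    intro H _ _
    rcases first_empty (2 * (n + 1 + 1)) H with h | ⟨k, hk⟩
    · exact iff_of_true (comb_ne_of_all (by omega) H h) (not_FO_of_all h)
    rw [FO_iff hk]
    have hE : IsEmpty (∀ j : Fin (2 * (n + 1 + 1)), H j) := pi_empty hk.1 hk.2.1
    rcases Nat.eq_zero_or_pos k with rfl | hk0
    · refine iff_of_true ⟨0, Matrix.PosSemidef.zero, fun S _ => ?_⟩ (by simp)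
      have := hk.2.1
      exact ⟨psd_empty _, Subsingleton.elim _ _⟩
    · have h0 := hk.2.2 0 hk0
      have step : (Comb (n + 1 + 1) H).Nonempty ↔ ¬ (Comb (n + 1) (fun i => H (i + 1))).Nonempty := by
        constructor
        · rintro ⟨R, -, hR⟩ ⟨S, hS⟩
          have h1 := (hR S hS).2
          have h2 := congrFun (congrFun h1 h0.some) h0.some
          rw [Matrix.one_apply_eq] at h2
          refine zero_ne_one (Eq.trans ?_ h2)
          symm
          refine Finset.sum_eq_zero fun b _ => ?_
          have hE' : IsEmpty (H 0 × (∀ j : Fin (2 * (n + 1)), H (j + 1)) × H (2 * (n + 1) + 1)) :=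
            (splitEnds H (2 * (n + 1))).symm.isEmpty
          unfold ptrMid
          exact Finset.sum_eq_zero fun c _ => (hE'.false (h0.some, c, b)).elim
        · intro h
          exact ⟨0, Matrix.PosSemidef.zero, fun S hS => absurd ⟨S, hS⟩ h⟩
      rw [step, ih, not_not]
      have hk1 := hk.1
      have hkk : k - 1 + 1 = k := by omega
      rcases Nat.lt_or_ge (k - 1) (2 * (n + 1)) with h | h
      · have : FE (2 * (n + 1)) (fun i => H (i + 1)) (k - 1) :=
          ⟨h, by simp only [hkk]; exact hk.2.1, fun j hj => hk.2.2 _ (by omega)⟩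
        rw [FO_iff this]
        simp only [Nat.odd_iff]; omega
      · have : ∀ j < 2 * (n + 1), Nonempty (H (j + 1)) := fun j hj => hk.2.2 _ (by omega)
        refine iff_of_false (not_FO_of_all this) ?_
        simp only [Nat.odd_iff]; omega

theorem comb_ne_iff' {n : ℕ} (hn : 1 ≤ n) (H : ℕ → Type) [∀ j, Fintype (H j)]
    [∀ j, DecidableEq (H j)] : (Comb n H).Nonempty ↔ ¬ FO n H := by
  obtain ⟨n, rfl⟩ : ∃ k, n = k + 1 := ⟨n - 1, by omega⟩
  exact comb_ne_iff n H

theorem FO_perm {q N : ℕ} {H : ℕ → Type} {σ : Equiv.Perm (Fin q)} {π : ℕ → ℕ} (h : IsInv σ π)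
    (hq : q = 2 * N) {j0 : ℕ} (hj : j0 < q) (he : IsEmpty (H j0))
    (hb : ∀ j < q, π j < π j0 → Nonempty (H j)) :
    FO N (fun i => H (extendPerm σ i)) ↔ Odd (π j0) := by
  refine FO_iff ⟨hq ▸ inv_lt h hj, ?_, fun j hj' => ?_⟩
  · simp only [ext_inv h hj]; exact he
  · have hjq : j < q := hj'.trans (inv_lt h hj)
    exact hb _ (ext_lt σ hjq) (by rwa [inv_ext h hjq])

variable {m n : ℕ} {H : ℕ → Type} [∀ j, Fintype (H j)] [∀ j, DecidableEq (H j)]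

theorem KS_ne {q N : ℕ} (hN : 1 ≤ N) (σ : Equiv.Perm (Fin q)) (hq : q = 2 * N)
    (hE : IsEmpty (∀ j : Fin q, H j)) :
    (KS H σ hq).Nonempty ↔ ¬ FO N (fun i => H (extendPerm σ i)) := by
  rw [← comb_ne_iff' hN]
  have hE' : IsEmpty (∀ j : Fin (2 * N), H (extendPerm σ j)) :=
    ((permEquiv H σ).trans (piFinCast (fun i => H (extendPerm σ i)) hq)).symm.isEmpty
  constructor
  · rintro ⟨R, -, h⟩; exact ⟨_, h⟩
  · rintro ⟨S, h⟩
    refine ⟨0, Matrix.PosSemidef.zero, ?_⟩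
    convert h
    exact Subsingleton.elim _ _

theorem degen (hm : 1 ≤ m) (hn : 1 ≤ n) (hq : 2 * m + 2 * n = 2 * (m + n))
    (hE : ∃ j < 2 * m + 2 * n, IsEmpty (H j))
    (R : Matrix (∀ j : Fin (2 * m + 2 * n), H j) (∀ j : Fin (2 * m + 2 * n), H j) ℂ) :
    (∀ M ∈ Comb m H,
        ptrLeft ((M ⊗ₖ (1 : Matrix (∀ j : Fin (2 * n), H (2 * m + j))
              (∀ j : Fin (2 * n), H (2 * m + j)) ℂ)) *
            (Matrix.reindex (splitPi (2 * m) (2 * n) H) (splitPi (2 * m) (2 * n) H) R)) ∈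
          Comb n (fun i => H (2 * m + i))) ↔
    R ∈ affineSpan ℝ (KS H (cycleKA m n hm hn) hq ∪ KS H (cycleKB m n hm hn) hq) := by
  have hEm : IsEmpty (∀ j : Fin (2 * m + 2 * n), H j) := by
    obtain ⟨j, h1, h2⟩ := hE
    exact pi_empty h1 h2
  have haff : R ∈ affineSpan ℝ (KS H (cycleKA m n hm hn) hq ∪ KS H (cycleKB m n hm hn) hq) ↔
      (¬ FO (m + n) (fun i => H (extendPerm (cycleKA m n hm hn) i)) ∨
        ¬ FO (m + n) (fun i => H (extendPerm (cycleKB m n hm hn) i))) := by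
    rw [← KS_ne (by omega) _ hq hEm, ← KS_ne (by omega) _ hq hEm, ← Set.union_nonempty]
    constructor
    · intro h
      exact (affineSpan_nonempty ℝ).mp ⟨R, h⟩
    · rintro ⟨S, hS⟩
      rw [Subsingleton.elim R S]
      exact subset_affineSpan ℝ _ hS
  rw [haff]
  have iA := inv_KA (m := m) (n := n) hm hn
  have iB := inv_KB (m := m) (n := n) hm hn
  have pA := parA (m := m) (n := n) hn
  have pB := parB (m := m) (n := n) hn
  rcases first_empty (2 * n) (fun i => H (2 * m + i)) with hB | ⟨k, hk⟩
  · -- no empty factor in the target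
    rcases first_empty (2 * m) H with hA | ⟨l, hl⟩
    · exfalso
      obtain ⟨j, h1, h2⟩ := hE
      rcases Nat.lt_or_ge j (2 * m) with h | h
      · exact absurd (hA j h) (not_nonempty_iff.mpr h2)
      · obtain ⟨i, rfl⟩ := Nat.exists_eq_add_of_le h
        exact absurd (hB i (by omega)) (not_nonempty_iff.mpr h2)
    · have hl1 := hl.1
      have fa := FO_perm (H := H) iA hq (j0 := l) (by omega) hl.2.1 (fun j hj h => by
        rw [piA_A hl1] at h
        rcases Nat.lt_or_ge j (2 * m) with h1 | h1
        · rw [piA_A h1] at h; exact hl.2.2 j (by omega)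
        · obtain ⟨i, rfl⟩ := Nat.exists_eq_add_of_le h1
          exact hB i (by omega))
      have fb := FO_perm (H := H) iB hq (j0 := l) (by omega) hl.2.1 (fun j hj h => by
        rw [piB_A hl1] at h
        rcases Nat.lt_or_ge j (2 * m) with h1 | h1
        · rw [piB_A h1] at h; exact hl.2.2 j (by omega)
        · obtain ⟨i, rfl⟩ := Nat.exists_eq_add_of_le h1
          exact hB i (by omega))
      rw [fa, fb, Nat.not_odd_iff_even, Nat.not_odd_iff_even, pA.1 l hl1, pB.1 l hl1, or_self]
      constructor
      · intro h he
        have hne : (Comb m H).Nonempty := by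
          rw [comb_ne_iff' hm, FO_iff hl, Nat.not_odd_iff_even]; exact he
        obtain ⟨M, hM⟩ := hne
        have h1 := ((comb_iff' hn _ hB _).mp (h M hM)).2.1
        have hEA : IsEmpty (∀ j : Fin (2 * m), H j) := pi_empty hl1 hl.2.1
        have h2 := dE_pos hB
        have h3 : (0 : ℂ) = (dE (2 * n) (fun i => H (2 * m + i)) : ℂ) := by
          rw [← h1]
          symm
          refine Finset.sum_eq_zero fun b _ => ?_
          rw [Matrix.diag_apply, ptrLeft, Finset.univ_eq_empty, Finset.sum_empty]
        exact h2.ne (by exact_mod_cast h3)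
      · intro h M hM
        exfalso
        have := (comb_ne_iff' hm H).mp ⟨M, hM⟩
        rw [FO_iff hl, Nat.not_odd_iff_even] at this
        exact h this
  · have hEB : IsEmpty (∀ j : Fin (2 * n), H (2 * m + j)) :=
      pi_empty (H := fun i => H (2 * m + i)) hk.1 hk.2.1
    have hk1 := hk.1
    have lhs : (∀ M ∈ Comb m H,
        ptrLeft ((M ⊗ₖ (1 : Matrix (∀ j : Fin (2 * n), H (2 * m + j))
              (∀ j : Fin (2 * n), H (2 * m + j)) ℂ)) *
            (Matrix.reindex (splitPi (2 * m) (2 * n) H) (splitPi (2 * m) (2 * n) H) R)) ∈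
          Comb n (fun i => H (2 * m + i))) ↔ (FO m H ∨ ¬ FO n (fun i => H (2 * m + i))) := by
      have hFO : FO m H ↔ ¬ (Comb m H).Nonempty := by rw [comb_ne_iff' hm, not_not]
      rw [← comb_ne_iff' hn, hFO]
      constructor
      · intro h
        by_cases hc : (Comb m H).Nonempty
        · obtain ⟨M, hM⟩ := hc
          exact Or.inr ⟨_, h M hM⟩
        · exact Or.inl hc
      · rintro (h | ⟨S, hS⟩) M hM
        · exact absurd ⟨M, hM⟩ h
        · convert hS
          exact Subsingleton.elim _ _
    rw [lhs, FO_iff hk]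
    rcases Nat.even_or_odd k with he | ho
    · have hkn : k < 2 * n - 1 := by
        rw [Nat.even_iff] at he; omega
      have fb := FO_perm (H := H) iB hq (j0 := 2 * m + k) (by omega) hk.2.1 (fun j hj h => by
        rw [piB_B hkn] at h
        rcases Nat.lt_or_ge j (2 * m) with h1 | h1
        · rw [piB_A h1] at h; omega
        · obtain ⟨i, rfl⟩ := Nat.exists_eq_add_of_le h1
          rcases Nat.lt_or_ge i (2 * n - 1) with h2 | h2
          · rw [piB_B h2] at h; exact hk.2.2 i h
          · unfold piB at h
            rw [if_neg (by omega), if_neg (by omega)] at h; omega)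
      rw [fb, piB_B hkn]
      have := Nat.not_odd_iff_even.mpr he
      exact iff_of_true (Or.inr this) (Or.inr this)
    · have hB0 : Nonempty (H (2 * m)) := hk.2.2 0 ho.pos
      rcases first_empty (2 * m) H with hA | ⟨l, hl⟩
      · have fa := FO_perm (H := H) iA hq (j0 := 2 * m + k) (by omega) hk.2.1 (fun j hj h => by
          rw [piA_B ho.pos] at h
          rcases Nat.lt_or_ge j (2 * m) with h1 | h1
          · exact hA j h1
          · obtain ⟨i, rfl⟩ := Nat.exists_eq_add_of_le h1
            rcases Nat.eq_zero_or_pos i with rfl | h2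
            · exact hB0
            · rw [piA_B h2] at h; exact hk.2.2 i (by omega))
        have fb := FO_perm (H := H) iB hq (j0 := 2 * m + k) (by omega) hk.2.1 (fun j hj h => by
          rcases Nat.lt_or_ge j (2 * m) with h1 | h1
          · exact hA j h1
          · obtain ⟨i, rfl⟩ := Nat.exists_eq_add_of_le h1
            refine hk.2.2 i ?_
            unfold piB at h
            split_ifs at h <;> omega)
        rw [fa, fb, ← Nat.not_even_iff_odd, ← Nat.not_even_iff_odd, ← Nat.not_even_iff_odd,
          pA.2 k hk1, pB.2 k hk1]
        have h1 := not_FO_of_all hA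
        have h2 := Nat.not_even_iff_odd.mpr ho
        tauto
      · have hl1 := hl.1
        have fa := FO_perm (H := H) iA hq (j0 := l) (by omega) hl.2.1 (fun j hj h => by
          rw [piA_A hl1] at h
          rcases Nat.lt_or_ge j (2 * m) with h1 | h1
          · rw [piA_A h1] at h; exact hl.2.2 j (by omega)
          · obtain ⟨i, rfl⟩ := Nat.exists_eq_add_of_le h1
            rcases Nat.eq_zero_or_pos i with rfl | h2
            · exact hB0
            · rw [piA_B h2] at h; omega)
        rw [FO_iff hl, fa, piA_A hl1]
        rcases Nat.even_or_odd l with hle | hlo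
        · have h1 : FO (m + n) (fun i => H (extendPerm (cycleKB m n hm hn) i)) := by
            rcases Nat.lt_or_ge k (2 * n - 1) with hkn | hkn
            · rw [FO_perm (H := H) iB hq (j0 := 2 * m + k) (by omega) hk.2.1 (fun j hj h => by
                rw [piB_B hkn] at h
                rcases Nat.lt_or_ge j (2 * m) with h1 | h1
                · rw [piB_A h1] at h; omega
                · obtain ⟨i, rfl⟩ := Nat.exists_eq_add_of_le h1
                  refine hk.2.2 i ?_
                  unfold piB at h
                  split_ifs at h <;> omega), piB_B hkn]
              exact ho
            · rw [FO_perm (H := H) iB hq (j0 := l) (by omega) hl.2.1 (fun j hj h => by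
                rw [piB_A hl1] at h
                rcases Nat.lt_or_ge j (2 * m) with h1 | h1
                · rw [piB_A h1] at h; exact hl.2.2 j (by omega)
                · obtain ⟨i, rfl⟩ := Nat.exists_eq_add_of_le h1
                  refine hk.2.2 i ?_
                  unfold piB at h
                  split_ifs at h <;> omega), ← Nat.not_even_iff_odd, pB.1 l hl1, not_not]
              exact hle
          have h2 := Nat.not_odd_iff_even.mpr hle
          have h3 := hle.add_one
          tauto
        · refine iff_of_true (Or.inl hlo) (Or.inl ?_)
          rw [Nat.not_odd_iff_even]; exact hlo.add_one

end Degenerate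
/-- `D(m→n)`, the set of deterministic maps from `m`-combs on
`A_0,…,A_{2m−1} := H_0,…,H_{2m−1}` to `n`-combs on `B_0,…,B_{2n−1} := H_{2m},…,H_{2m+2n−1}`,
equals the intersection of the PSD operators with the affine span (over ℝ) of `K_a ∪ K_b`,
where `K_a` (resp. `K_b`) is the set of PSD operators which are deterministic
`(m+n)`-combs with respect to the tooth ordering
`(B_0,A_0),(A_1,A_2),…,(A_{2m−3},A_{2m−2}),(A_{2m−1},B_1),(B_2,B_3),…,(B_{2n−2},B_{2n−1})`
(resp. `(B_0,B_1),…,(B_{2n−4},B_{2n−3}),(B_{2n−2},A_0),(A_1,A_2),…,(A_{2m−3},A_{2m−2}),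
(A_{2m−1},B_{2n−1})`). -/
theorem stmt_0 (m n : ℕ) (hm : 1 ≤ m) (hn : 1 ≤ n) (H : ℕ → Type)
    [∀ j, Fintype (H j)] [∀ j, DecidableEq (H j)] :
    {R : Matrix (∀ j : Fin (2 * m + 2 * n), H j) (∀ j : Fin (2 * m + 2 * n), H j) ℂ |
      R.PosSemidef ∧ ∀ M ∈ Comb m H,
        ptrLeft ((M ⊗ₖ (1 : Matrix (∀ j : Fin (2 * n), H (2 * m + j))
              (∀ j : Fin (2 * n), H (2 * m + j)) ℂ)) *
            (Matrix.reindex (splitPi (2 * m) (2 * n) H) (splitPi (2 * m) (2 * n) H) R)) ∈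
          Comb n (fun i => H (2 * m + i))} =
      {R : Matrix (∀ j : Fin (2 * m + 2 * n), H j) (∀ j : Fin (2 * m + 2 * n), H j) ℂ |
        R.PosSemidef} ∩
      (affineSpan ℝ (
        {R : Matrix (∀ j : Fin (2 * m + 2 * n), H j) (∀ j : Fin (2 * m + 2 * n), H j) ℂ |
          R.PosSemidef ∧
          Matrix.reindex
              ((permEquiv H (cycleKA m n hm hn)).trans
                (piFinCast (fun i => H (extendPerm (cycleKA m n hm hn) i))
                  (by omega : 2 * m + 2 * n = 2 * (m + n))))
              ((permEquiv H (cycleKA m n hm hn)).trans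
                (piFinCast (fun i => H (extendPerm (cycleKA m n hm hn) i))
                  (by omega : 2 * m + 2 * n = 2 * (m + n)))) R ∈
            Comb (m + n) (fun i => H (extendPerm (cycleKA m n hm hn) i))} ∪
        {R : Matrix (∀ j : Fin (2 * m + 2 * n), H j) (∀ j : Fin (2 * m + 2 * n), H j) ℂ |
          R.PosSemidef ∧
          Matrix.reindex
              ((permEquiv H (cycleKB m n hm hn)).trans
                (piFinCast (fun i => H (extendPerm (cycleKB m n hm hn) i))
                  (by omega : 2 * m + 2 * n = 2 * (m + n))))
              ((permEquiv H (cycleKB m n hm hn)).trans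
                (piFinCast (fun i => H (extendPerm (cycleKB m n hm hn) i))
                  (by omega : 2 * m + 2 * n = 2 * (m + n)))) R ∈
            Comb (m + n) (fun i => H (extendPerm (cycleKB m n hm hn) i))}) :
       Set (Matrix (∀ j : Fin (2 * m + 2 * n), H j) (∀ j : Fin (2 * m + 2 * n), H j) ℂ)) := by
  have hq : 2 * m + 2 * n = 2 * (m + n) := by omega
  ext R
  change (R.PosSemidef ∧ _) ↔ R.PosSemidef ∧
    R ∈ affineSpan ℝ (KS H (cycleKA m n hm hn) hq ∪ KS H (cycleKB m n hm hn) hq)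
  refine and_congr_right fun hR => ?_
  by_cases hne : ∀ j < 2 * m + 2 * n, Nonempty (H j)
  · constructor
    · intro hD
      exact P_to_aff hm hn hne hq hR.isHermitian (D_to_P hm hn hne R hD)
    · intro h
      exact P_to_D hm hn hne R hR (aff_to_P hm hn hne hq h)
  · push Not at hne
    obtain ⟨j, h1, h2⟩ := hne
    exact degen hm hn hq ⟨j, h1, by simpa using h2⟩ R

end
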